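/- arXiv:1903.07861 — 4 statements merged into one kernel-verified Lean document; each statement's English description precedes it below -/
import Mathlib

section
/- Let ξ = (ξ_1, ξ_2, …) be an infinite stationary sequence of random variables with values in a standard Borel space S, with empirical distributions η_n = n⁻¹ ∑_{i=1}^n δ_{ξ_i}. If η is a reverse measure-valued martingale (with respect to the tail σ-fields 𝒯_n = σ(η_n, η_{n+1}, …)), then ξ is exchangeable. -/
open MeasureTheory ProbabilityTheory
open scoped ENNReal

/-- The empirical distribution `η_n = n⁻¹ ∑_{i=1}^n δ_{ξ_i}` of the first `n` terms of
the sequence `ξ` (indexed from `0`). -/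
noncomputable def empDist {Ω S : Type*} [MeasurableSpace S] (ξ : ℕ → Ω → S) (n : ℕ) (ω : Ω) :
    Measure S :=
  (n : ℝ≥0∞)⁻¹ • ∑ i ∈ Finset.range n, Measure.dirac (ξ i ω)

/-- The tail σ-field `𝒯_n = σ(η_n, η_{n+1}, …)` generated by the empirical distributions. -/
noncomputable def tailField {Ω S : Type*} [MeasurableSpace S] (ξ : ℕ → Ω → S) (n : ℕ) :
    MeasurableSpace Ω :=
  ⨆ k, ⨆ _ : n ≤ k, MeasurableSpace.comap (empDist ξ k) inferInstance

/-- `η` is a reverse measure-valued martingale: for every bounded measurable `f` and all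
`1 ≤ k ≤ n`, `E[η_k f | 𝒯_n] = η_n f` a.s. -/
def IsReverseMVM {Ω S : Type*} [MeasurableSpace Ω] [MeasurableSpace S]
    (P : Measure Ω) (ξ : ℕ → Ω → S) : Prop :=
  ∀ f : S → ℝ, Measurable f → (∃ C, ∀ x, |f x| ≤ C) →
    ∀ k n : ℕ, 1 ≤ k → k ≤ n →
      P[(fun ω => ∫ x, f x ∂(empDist ξ k ω)) | tailField ξ n]
        =ᵐ[P] fun ω => ∫ x, f x ∂(empDist ξ n ω)

/-- `ξ` is exchangeable: any finite subfamily with distinct indices has the same joint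
distribution as the initial segment of the same length. -/
def Exchangeable {Ω S : Type*} [MeasurableSpace Ω] [MeasurableSpace S]
    (P : Measure Ω) (ξ : ℕ → Ω → S) : Prop :=
  ∀ (m : ℕ) (k : Fin m → ℕ), Function.Injective k →
    Measure.map (fun ω (i : Fin m) => ξ (k i) ω) P
      = Measure.map (fun ω (i : Fin m) => ξ (i : ℕ) ω) P

/-- `ξ` is stationary: the shifted sequence has the same distribution as `ξ`. -/
def Stationary {Ω S : Type*} [MeasurableSpace Ω] [MeasurableSpace S]
    (P : Measure Ω) (ξ : ℕ → Ω → S) : Prop :=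
  Measure.map (fun ω (i : ℕ) => ξ (i + 1) ω) P = Measure.map (fun ω (i : ℕ) => ξ i ω) P

/-- `ξ` is a homogeneous Markov sequence with transition kernel `κ`. -/
def IsHomogeneousMarkov {Ω S : Type*} [MeasurableSpace Ω] [MeasurableSpace S]
    (P : Measure Ω) (ξ : ℕ → Ω → S) : Prop :=
  ∃ κ : Kernel S S, IsMarkovKernel κ ∧
    ∀ n : ℕ, ∀ f : S → ℝ, Measurable f → (∃ C, ∀ x, |f x| ≤ C) →
      P[(fun ω => f (ξ (n + 1) ω)) |
          MeasurableSpace.comap (fun ω (i : Fin (n + 1)) => ξ (i : ℕ) ω) inferInstance]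
        =ᵐ[P] fun ω => ∫ y, f y ∂(κ (ξ n ω))

/-- Number of indices `i < n` with `y i = a`. -/
noncomputable def cntOf {C : Type*} [DecidableEq C] (n : ℕ) (y : ℕ → C) (a : C) : ℕ :=
  ((Finset.range n).filter (fun i => y i = a)).card

lemma cntOf_succ {C : Type*} [DecidableEq C] (n : ℕ) (y : ℕ → C) (a : C) :
    cntOf (n + 1) y a = cntOf n y a + if y n = a then 1 else 0 := by
  unfold cntOf
  rw [Finset.range_add_one, Finset.filter_insert]
  split_ifs with h
  · rw [Finset.card_insert_of_notMem (by simp)]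
  · simp

lemma prod_factorial_succ {C : Type*} [Fintype C] [DecidableEq C] (n : ℕ) (y : ℕ → C) :
    ∏ a, (cntOf (n + 1) y a).factorial
      = cntOf (n + 1) y (y n) * ∏ a, (cntOf n y a).factorial := by
  rw [← Finset.mul_prod_erase _ _ (Finset.mem_univ (y n)),
    ← Finset.mul_prod_erase _ (fun a => (cntOf n y a).factorial) (Finset.mem_univ (y n)),
    ← mul_assoc]
  congr 1
  · rw [cntOf_succ, if_pos rfl, Nat.factorial_succ]
  · refine Finset.prod_congr rfl fun a ha => ?_
    rw [cntOf_succ, if_neg (fun h => (Finset.ne_of_mem_erase ha) h.symm), add_zero]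

lemma empDist_apply {Ω S C : Type*} [MeasurableSpace S] [DecidableEq C]
    (ξ : ℕ → Ω → S) (φ : S → C) (hφ : ∀ a, MeasurableSet (φ ⁻¹' {a})) (n : ℕ) (ω : Ω) (a : C) :
    empDist ξ n ω (φ ⁻¹' {a}) = (n : ℝ≥0∞)⁻¹ * cntOf n (fun i => φ (ξ i ω)) a := by
  unfold empDist cntOf
  rw [Measure.smul_apply, Measure.finsetSum_apply, smul_eq_mul]
  congr 1
  rw [Finset.card_filter]
  push_cast
  refine Finset.sum_congr rfl fun i _ => ?_
  rw [Measure.dirac_apply' _ (hφ a)]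
  by_cases h : φ (ξ i ω) = a
  · rw [if_pos h, Set.indicator_of_mem (show ξ i ω ∈ φ ⁻¹' {a} from h)]; rfl
  · rw [if_neg h, Set.indicator_of_notMem (show ξ i ω ∉ φ ⁻¹' {a} from h)]

lemma empDist_real {Ω S C : Type*} [MeasurableSpace S] [DecidableEq C]
    (ξ : ℕ → Ω → S) (φ : S → C) (hφ : ∀ a, MeasurableSet (φ ⁻¹' {a})) (n : ℕ) (ω : Ω) (a : C) :
    (empDist ξ n ω).real (φ ⁻¹' {a}) = (n : ℝ)⁻¹ * cntOf n (fun i => φ (ξ i ω)) a := by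
  rw [measureReal_def, empDist_apply ξ φ hφ]
  simp

lemma measurable_empDist {Ω S : Type*} [MeasurableSpace Ω] [MeasurableSpace S]
    (ξ : ℕ → Ω → S) (hmeas : ∀ i, Measurable (ξ i)) (n : ℕ) : Measurable (empDist ξ n) := by
  refine Measure.measurable_of_measurable_coe _ fun s hs => ?_
  simp only [empDist, Measure.smul_apply, Measure.finsetSum_apply, smul_eq_mul]
  refine Measurable.const_mul (Finset.measurable_sum _ fun i _ => ?_) _
  exact (Measure.measurable_coe hs).comp (Measure.measurable_dirac.comp (hmeas i))

lemma tailField_le {Ω S : Type*} [mΩ : MeasurableSpace Ω] [MeasurableSpace S]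
    (ξ : ℕ → Ω → S) (hmeas : ∀ i, Measurable (ξ i)) (n : ℕ) : tailField ξ n ≤ mΩ :=
  iSup₂_le fun k _ => (measurable_empDist ξ hmeas k).comap_le

lemma measurable_cntOf {Ω S C : Type*} [MeasurableSpace S] [DecidableEq C]
    (ξ : ℕ → Ω → S) (φ : S → C) (hφ : ∀ a, MeasurableSet (φ ⁻¹' {a})) (n k : ℕ) (hk : n ≤ k)
    (a : C) :
    Measurable[tailField ξ n] (fun ω => (cntOf k (fun i => φ (ξ i ω)) a : ℝ)) := by
  have h1 : Measurable[tailField ξ n] (empDist ξ k) := by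
    have : MeasurableSpace.comap (empDist ξ k) inferInstance ≤ tailField ξ n :=
      le_iSup₂_of_le k hk le_rfl
    exact (comap_measurable _).mono this le_rfl
  have h2 : Measurable[tailField ξ n]
      (fun ω => (k : ℝ) * (empDist ξ k ω (φ ⁻¹' {a})).toReal) :=
    ((Measure.measurable_coe (hφ a)).comp h1).ennreal_toReal.const_mul _
  convert h2 using 2 with ω
  have := empDist_real ξ φ hφ k ω a
  rw [measureReal_def] at this
  rw [this]
  rcases Nat.eq_zero_or_pos k with rfl | hk0
  · simp [cntOf]
  · field_simp

/-- The event that the first `n` values have the same counts as `c` and the values with indices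
in `[n, N)` are exactly those of `c`. -/
def cntEvent {Ω S C : Type*} [DecidableEq C] (ξ : ℕ → Ω → S) (φ : S → C) (c : ℕ → C)
    (N n : ℕ) : Set Ω :=
  {ω | (∀ a, cntOf n (fun i => φ (ξ i ω)) a = cntOf n c a) ∧
    ∀ i, n ≤ i → i < N → φ (ξ i ω) = c i}

lemma measurableSet_cntEvent {Ω S C : Type*} [MeasurableSpace S] [Fintype C] [DecidableEq C]
    (ξ : ℕ → Ω → S) (φ : S → C) (hφ : ∀ a, MeasurableSet (φ ⁻¹' {a})) (c : ℕ → C) (N n : ℕ) :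
    MeasurableSet[tailField ξ n] (cntEvent ξ φ c N n) := by
  have : cntEvent ξ φ c N n =
      (⋂ a, {ω | (cntOf n (fun i => φ (ξ i ω)) a : ℝ) = cntOf n c a}) ∩
      ⋂ i, ⋂ (_ : n ≤ i), ⋂ (_ : i < N), {ω | (cntOf (i + 1) (fun i => φ (ξ i ω)) (c i) : ℝ)
        = cntOf i (fun i => φ (ξ i ω)) (c i) + 1} := by
    ext ω
    simp only [cntEvent, Set.mem_ofPred_eq, Set.mem_inter_iff, Set.mem_iInter, Nat.cast_inj]
    refine and_congr Iff.rfl (forall_congr' fun i => forall_congr' fun _ => forall_congr' fun _ => ?_)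
    rw [cntOf_succ]
    split_ifs with h <;> simp [h]
  rw [this]
  refine MeasurableSet.inter (MeasurableSet.iInter fun a => ?_)
    (MeasurableSet.iInter fun i => MeasurableSet.iInter fun hi => MeasurableSet.iInter fun _ => ?_)
  · exact measurableSet_eq_fun (m := tailField ξ n)
      (measurable_cntOf ξ φ hφ n n le_rfl a) measurable_const
  · exact measurableSet_eq_fun (m := tailField ξ n)
      (measurable_cntOf ξ φ hφ n (i + 1) (by omega) (c i))
      ((measurable_cntOf ξ φ hφ n i hi (c i)).add_const 1)

lemma cntEvent_eq_inter {Ω S C : Type*} [DecidableEq C]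
    (ξ : ℕ → Ω → S) (φ : S → C) (c : ℕ → C) (N n : ℕ) (hn : n < N) :
    cntEvent ξ φ c N n = cntEvent ξ φ c N (n + 1) ∩ {ω | φ (ξ n ω) = c n} := by
  ext ω
  simp only [cntEvent, Set.mem_ofPred_eq, Set.mem_inter_iff, cntOf_succ]
  constructor
  · rintro ⟨h1, h2⟩
    have h3 := h2 n le_rfl hn
    refine ⟨⟨fun a => by rw [h1, h3], fun i hi hi' => h2 i (by omega) hi'⟩, h3⟩
  · rintro ⟨⟨h1, h2⟩, h3⟩
    refine ⟨fun a => by have := h1 a; rw [h3] at this; omega, fun i hi hi' => ?_⟩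
    rcases hi.eq_or_lt with rfl | h
    · exact h3
    · exact h2 i h hi'

lemma setIntegral_cnt {Ω S C : Type*} [MeasurableSpace Ω] [MeasurableSpace S]
    [Fintype C] [DecidableEq C] (P : Measure Ω) [IsProbabilityMeasure P] (ξ : ℕ → Ω → S)
    (hmeas : ∀ i, Measurable (ξ i)) (hmart : IsReverseMVM P ξ)
    (φ : S → C) (hφ : ∀ a, MeasurableSet (φ ⁻¹' {a})) (n k : ℕ) (hk : k ≤ n)
    (a : C) (E : Set Ω) (hE : MeasurableSet[tailField ξ n] E) :
    n * ∫ ω in E, (cntOf k (fun i => φ (ξ i ω)) a : ℝ) ∂P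
      = k * ∫ ω in E, (cntOf n (fun i => φ (ξ i ω)) a : ℝ) ∂P := by
  rcases Nat.eq_zero_or_pos k with rfl | hk0
  · simp [cntOf]
  have key : ∀ m ω, ∫ x, (φ ⁻¹' {a}).indicator (1 : S → ℝ) x ∂(empDist ξ m ω)
      = (m : ℝ)⁻¹ * cntOf m (fun i => φ (ξ i ω)) a := fun m ω => by
    rw [integral_indicator_one (hφ a), empDist_real ξ φ hφ]
  have h := hmart ((φ ⁻¹' {a}).indicator 1) (measurable_one.indicator (hφ a))
    ⟨1, fun x => by by_cases hx : x ∈ φ ⁻¹' {a} <;> simp [hx]⟩ k n hk0 hk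
  simp only [key] at h
  have hle := tailField_le ξ hmeas n
  have hint : Integrable (fun ω => (k : ℝ)⁻¹ * (cntOf k (fun i => φ (ξ i ω)) a : ℝ)) P := by
    refine Integrable.const_mul ?_ _
    refine Integrable.of_bound
      (((measurable_cntOf ξ φ hφ 0 k (Nat.zero_le _) a).mono
        (tailField_le ξ hmeas 0) le_rfl).aestronglyMeasurable) (k : ℝ)
      (Filter.Eventually.of_forall fun ω => ?_)
    simp only [Real.norm_natCast, Nat.cast_le]
    exact (Finset.card_filter_le _ _).trans (by simp)
  have h2 := setIntegral_condExp hle hint hE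
  rw [setIntegral_congr_ae (hle _ hE) (h.mono fun ω hω _ => hω), integral_const_mul,
    integral_const_mul] at h2
  have hk' : (k : ℝ) ≠ 0 := by positivity
  have hn' : (n : ℝ) ≠ 0 := by have : 0 < n := by omega
                               positivity
  field_simp at h2
  linarith

lemma cntEvent_step {Ω S C : Type*} [MeasurableSpace Ω] [MeasurableSpace S]
    [Fintype C] [DecidableEq C] (P : Measure Ω) [IsProbabilityMeasure P] (ξ : ℕ → Ω → S)
    (hmeas : ∀ i, Measurable (ξ i)) (hmart : IsReverseMVM P ξ)
    (φ : S → C) (hφ : ∀ a, MeasurableSet (φ ⁻¹' {a})) (c : ℕ → C) (N n : ℕ) (hn : n < N) :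
    (n + 1) * P.real (cntEvent ξ φ c N n)
      = cntOf (n + 1) c (c n) * P.real (cntEvent ξ φ c N (n + 1)) := by
  set E := cntEvent ξ φ c N (n + 1) with hEdef
  have hE := measurableSet_cntEvent ξ φ hφ c N (n + 1)
  have hle := tailField_le ξ hmeas (n + 1)
  have hE' : MeasurableSet E := hle _ hE
  have h := setIntegral_cnt P ξ hmeas hmart φ hφ (n + 1) n (Nat.le_succ n) (c n) E hE
  have hA : MeasurableSet {ω | φ (ξ n ω) = c n} := hmeas n (hφ (c n))
  have hcnt : ∫ ω in E, (cntOf (n + 1) (fun i => φ (ξ i ω)) (c n) : ℝ) ∂P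
      = cntOf (n + 1) c (c n) * P.real E := by
    rw [setIntegral_congr_fun hE' (g := fun _ => (cntOf (n + 1) c (c n) : ℝ))
      (fun ω hω => by simp only [hω.1 (c n)])]
    simp [mul_comm]
  have hsplit : ∫ ω in E, (cntOf n (fun i => φ (ξ i ω)) (c n) : ℝ) ∂P
      = cntOf (n + 1) c (c n) * P.real E - P.real (cntEvent ξ φ c N n) := by
    rw [setIntegral_congr_fun hE' (g := fun ω => (cntOf (n + 1) c (c n) : ℝ)
      - {ω | φ (ξ n ω) = c n}.indicator (1 : Ω → ℝ) ω)]
    · rw [integral_sub (integrable_const _)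
        (show Integrable ({ω | φ (ξ n ω) = c n}.indicator (1 : Ω → ℝ)) (P.restrict E) from
          (integrable_const (1 : ℝ)).indicator hA), integral_indicator_one hA,
        measureReal_restrict_apply hA, cntEvent_eq_inter ξ φ c N n hn, Set.inter_comm, ← hEdef]
      simp [mul_comm]
    · intro ω hω
      have := hω.1 (c n)
      simp only [← this, cntOf_succ, Set.indicator_apply, Set.mem_ofPred_eq]
      split_ifs <;> simp
  rw [hcnt, hsplit] at h
  push_cast at h
  linarith

lemma cntEvent_formula {Ω S C : Type*} [MeasurableSpace Ω] [MeasurableSpace S]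
    [Fintype C] [DecidableEq C] (P : Measure Ω) [IsProbabilityMeasure P] (ξ : ℕ → Ω → S)
    (hmeas : ∀ i, Measurable (ξ i)) (hmart : IsReverseMVM P ξ)
    (φ : S → C) (hφ : ∀ a, MeasurableSet (φ ⁻¹' {a})) (c : ℕ → C) (N n : ℕ) (hn : n ≤ N) :
    n.factorial * P.real (cntEvent ξ φ c N 0)
      = (∏ a, (cntOf n c a).factorial : ℕ) * P.real (cntEvent ξ φ c N n) := by
  induction n with
  | zero => simp [cntOf]
  | succ n ih =>
    have h1 := ih (by omega)
    have h2 := cntEvent_step P ξ hmeas hmart φ hφ c N n (by omega)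
    rw [prod_factorial_succ, Nat.factorial_succ]
    push_cast at h1 h2 ⊢
    rw [mul_assoc, h1]
    linear_combination (∏ a, ((cntOf n c a).factorial : ℝ)) * h2

lemma prob_eq_of_cntOf_eq {Ω S C : Type*} [MeasurableSpace Ω] [MeasurableSpace S]
    [Fintype C] [DecidableEq C] (P : Measure Ω) [IsProbabilityMeasure P] (ξ : ℕ → Ω → S)
    (hmeas : ∀ i, Measurable (ξ i)) (hmart : IsReverseMVM P ξ)
    (φ : S → C) (hφ : ∀ a, MeasurableSet (φ ⁻¹' {a})) (c c' : ℕ → C) (N : ℕ)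
    (hc : ∀ a, cntOf N c a = cntOf N c' a) :
    P {ω | ∀ i < N, φ (ξ i ω) = c i} = P {ω | ∀ i < N, φ (ξ i ω) = c' i} := by
  have h0 : ∀ d : ℕ → C, cntEvent ξ φ d N 0 = {ω | ∀ i < N, φ (ξ i ω) = d i} := fun d => by
    ext ω; simp [cntEvent, cntOf]
  have h1 := cntEvent_formula P ξ hmeas hmart φ hφ c N N le_rfl
  have h2 := cntEvent_formula P ξ hmeas hmart φ hφ c' N N le_rfl
  have h3 : cntEvent ξ φ c N N = cntEvent ξ φ c' N N := by
    ext ω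
    simp only [cntEvent, Set.mem_ofPred_eq, hc]
    refine and_congr Iff.rfl ⟨fun _ i hi hi' => by omega, fun _ i hi hi' => by omega⟩
  rw [h3] at h1
  simp only [hc] at h1
  rw [← h2, h0, h0] at h1
  have h4 : (N.factorial : ℝ) ≠ 0 := by positivity
  have h5 := mul_left_cancel₀ h4 h1
  rwa [measureReal_def, measureReal_def, ENNReal.toReal_eq_toReal_iff' (by simp) (by simp)] at h5

lemma perm_prob {Ω S C : Type*} [MeasurableSpace Ω] [MeasurableSpace S]
    [Fintype C] [DecidableEq C] [Inhabited C]
    (P : Measure Ω) [IsProbabilityMeasure P] (ξ : ℕ → Ω → S)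
    (hmeas : ∀ i, Measurable (ξ i)) (hmart : IsReverseMVM P ξ)
    (φ : S → C) (hφ : ∀ a, MeasurableSet (φ ⁻¹' {a})) (N : ℕ) (σ : Equiv.Perm (Fin N))
    (B : Set (Fin N → C)) :
    P {ω | (fun i : Fin N => φ (ξ (σ i) ω)) ∈ B} = P {ω | (fun i : Fin N => φ (ξ i ω)) ∈ B} := by
  classical
  letI : MeasurableSpace C := ⊤
  have hφm : Measurable φ := measurable_to_countable' hφ
  have m1 : Measurable (fun ω (i : Fin N) => φ (ξ (σ i) ω)) :=
    measurable_pi_lambda _ fun i => hφm.comp (hmeas _)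
  have m2 : Measurable (fun ω (i : Fin N) => φ (ξ i ω)) :=
    measurable_pi_lambda _ fun i => hφm.comp (hmeas _)
  have hB : MeasurableSet B := B.toFinite.measurableSet
  have : P.map (fun ω (i : Fin N) => φ (ξ (σ i) ω)) = P.map (fun ω (i : Fin N) => φ (ξ i ω)) := by
    refine Measure.ext_of_singleton fun d => ?_
    rw [Measure.map_apply m1 (measurableSet_singleton d),
      Measure.map_apply m2 (measurableSet_singleton d)]
    let ex : (Fin N → C) → ℕ → C := fun d i => if h : i < N then d ⟨i, h⟩ else default
    have hex : ∀ d (i : Fin N), ex d i = d i := fun d i => by simp [ex]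
    have hcnt : ∀ d a, cntOf N (ex d) a = (Finset.univ.filter fun i : Fin N => d i = a).card := by
      intro d a
      unfold cntOf
      rw [Finset.card_filter, Finset.card_filter, Finset.sum_range]
      simp only [hex]
    have h := prob_eq_of_cntOf_eq P ξ hmeas hmart φ hφ (ex (d ∘ σ.symm)) (ex d) N (fun a => by
      rw [hcnt, hcnt]
      refine Finset.card_equiv σ.symm fun i => ?_
      simp)
    convert h using 2
    · ext ω
      simp only [Set.mem_preimage, Set.mem_singleton_iff, Set.mem_ofPred_eq, funext_iff]
      constructor
      · intro h i hi
        have := h (σ.symm ⟨i, hi⟩)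
        simpa [ex, hi] using this
      · intro h i
        have := h (σ i) (σ i).2
        simpa [hex] using this
    · ext ω
      simp only [Set.mem_preimage, Set.mem_singleton_iff, Set.mem_ofPred_eq, funext_iff]
      constructor
      · intro h i hi
        simpa [ex, hi] using h ⟨i, hi⟩
      · intro h i
        simpa [hex] using h i i.2
  have h := congrArg (fun μ => μ B) this
  simp only [Measure.map_apply m1 hB, Measure.map_apply m2 hB] at h
  exact h

/-- **Main result.** If the empirical distributions of an infinite stationary
sequence in a standard Borel space form a reverse measure-valued martingale, then the
sequence is exchangeable. -/
theorem exchangeable_of_stationary_of_isReverseMVM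
    {Ω S : Type*} [MeasurableSpace Ω] [MeasurableSpace S] [StandardBorelSpace S]
    (P : Measure Ω) [IsProbabilityMeasure P] (ξ : ℕ → Ω → S)
    (hmeas : ∀ i, Measurable (ξ i)) (hstat : Stationary P ξ)
    (hmart : IsReverseMVM P ξ) :
    Exchangeable P ξ := by
  intro m k hk
  have mk : Measurable (fun ω (i : Fin m) => ξ (k i) ω) := measurable_pi_lambda _ fun i => hmeas _
  have mi : Measurable (fun ω (i : Fin m) => ξ (i : ℕ) ω) :=
    measurable_pi_lambda _ fun i => hmeas _
  haveI : IsProbabilityMeasure (Measure.map (fun ω (i : Fin m) => ξ (k i) ω) P) :=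
    Measure.isProbabilityMeasure_map mk.aemeasurable
  refine ext_of_generate_finite _ generateFrom_pi.symm isPiSystem_pi ?_ ?_
  · rintro _ ⟨A, hA, rfl⟩
    have hA' : ∀ i, MeasurableSet (A i) := fun i => hA i (Set.mem_univ i)
    have hmA : MeasurableSet (Set.univ.pi A) := MeasurableSet.univ_pi hA'
    rw [Measure.map_apply mk hmA, Measure.map_apply mi hmA]
    classical
    obtain ⟨N, hN⟩ : ∃ N, m ≤ N ∧ ∀ j, k j < N :=
      ⟨m + ∑ j, (k j + 1), by omega, fun j => by
        have := Finset.single_le_sum (f := fun j => k j + 1) (fun _ _ => Nat.zero_le _)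
          (Finset.mem_univ j)
        have h2 : k j + 1 ≤ ∑ j, (k j + 1) := this
        omega⟩
    obtain ⟨hmN, hkN⟩ := hN
    let x : Fin m ↪ Fin N := Fin.castLEEmb hmN
    let y : Fin m ↪ Fin N := ⟨fun j => ⟨k j, hkN j⟩, fun a b h => hk (by simpa using h)⟩
    obtain ⟨σ, hσ⟩ := (Equiv.Perm.isMultiplyPretransitive (Fin N) m).exists_smul_eq x y
    have hσ' : ∀ j, ((σ (Fin.castLE hmN j) : Fin N) : ℕ) = k j := fun j => by
      have := congrArg (fun e : Fin m ↪ Fin N => ((e j : Fin N) : ℕ)) hσ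
      simp only [x, y] at this
      exact this
    let φ : S → (Fin m → Bool) := fun s j => decide (s ∈ A j)
    have hφ : ∀ a, MeasurableSet (φ ⁻¹' {a}) := by
      have : Measurable φ := measurable_pi_lambda _ fun j => measurable_to_bool (by
        convert hA' j using 1
        ext s; simp [φ])
      exact fun a => this (measurableSet_singleton a)
    have h := perm_prob P ξ hmeas hmart φ hφ N σ
      {d | ∀ j : Fin m, d (Fin.castLE hmN j) j = true}
    convert h using 2
    · ext ω
      simp [φ, hσ']
    · ext ω
      simp [φ]
  · rw [Measure.map_apply mk MeasurableSet.univ, Measure.map_apply mi MeasurableSet.univ]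
    simp
end

section
/- Let ξ = (ξ_1, ξ_2, …) be an infinite stationary sequence of random variables with values in a standard Borel space S such that (ξ_1, ξ_2, ξ_3, …) has the same distribution as (ξ_2, ξ_1, ξ_3, …). Then for all n, m ∈ ℕ, the vector (ξ_1, …, ξ_{n+m+1}) has the same distribution as (ξ_1, …, ξ_n, ξ_{n+2}, ξ_{n+1}, ξ_{n+3}, …, ξ_{n+m+1}); i.e., the law of ξ is invariant under every adjacent transposition of coordinates. -/
open MeasureTheory ProbabilityTheory
open scoped ENNReal

namespace SwapAux

variable {S : Type*} [MeasurableSpace S]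

/-- The shift on sequences. -/
def T (x : ℕ → S) : ℕ → S := fun i => x (i + 1)

/-- The adjacent transposition on sequences. -/
def sw (j : ℕ) (x : ℕ → S) : ℕ → S := fun i => x (Equiv.swap j (j + 1) i)

lemma measurable_T : Measurable (T : (ℕ → S) → ℕ → S) :=
  measurable_pi_lambda _ fun i => measurable_pi_apply _

lemma measurable_sw (j : ℕ) : Measurable (sw j : (ℕ → S) → ℕ → S) :=
  measurable_pi_lambda _ fun i => measurable_pi_apply _

lemma T_iter (k : ℕ) (x : ℕ → S) : (T^[k]) x = fun i => x (i + k) := by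
  induction k generalizing x with
  | zero => rfl
  | succ k ih =>
    rw [Function.iterate_succ_apply, ih]
    funext i
    simp [T, add_assoc]

lemma T_iter_sw (j : ℕ) (x : ℕ → S) : (T^[j + 2]) (sw j x) = (T^[j + 2]) x := by
  rw [T_iter, T_iter]
  funext i
  simp only [sw]
  rw [Equiv.swap_apply_of_ne_of_ne (by omega) (by omega)]

lemma T_sw_succ (j : ℕ) (x : ℕ → S) : T (sw (j + 1) x) = sw j (T x) := by
  funext i
  simp only [T, sw, Equiv.swap_apply_def]
  split_ifs <;> first | rfl | omega

lemma sw_succ_zero (j : ℕ) (x : ℕ → S) : sw (j + 1) x 0 = x 0 := by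
  simp only [sw]
  rw [Equiv.swap_apply_of_ne_of_ne (by omega) (by omega)]

lemma TT_sw_zero (x : ℕ → S) : T (T (sw 0 x)) = T (T x) := T_iter_sw 0 x

/-- Conditional probability of the first coordinate given the future, as a function of the
future. -/
lemma exists_density (μ : Measure (ℕ → S)) [IsProbabilityMeasure μ]
    (hT : MeasurePreserving T μ μ) {A : Set S} (hA : MeasurableSet A) :
    ∃ m : (ℕ → S) → NNReal, Measurable m ∧ ∫⁻ x, (m x : ℝ≥0∞) * m x ∂μ ≠ ∞ ∧
      ∀ h : (ℕ → S) → ℝ≥0∞, Measurable h →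
        ∫⁻ x, A.indicator 1 (x 0) * h (T x) ∂μ = ∫⁻ x, (m x : ℝ≥0∞) * h x ∂μ := by
  have hE : MeasurableSet ((fun x : ℕ → S => x 0) ⁻¹' A) := measurable_pi_apply 0 hA
  set ν : Measure (ℕ → S) := (μ.restrict ((fun x : ℕ → S => x 0) ⁻¹' A)).map T with hν
  have hle : ν ≤ μ := by
    calc ν ≤ μ.map T := Measure.map_mono Measure.restrict_le_self measurable_T
      _ = μ := hT.map_eq
  have hac : ν ≪ μ := Measure.absolutelyContinuous_of_le hle
  have : IsFiniteMeasure ν := isFiniteMeasure_of_le μ hle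
  have hmm : Measurable (fun x => (ν.rnDeriv μ x).toNNReal) :=
    (Measure.measurable_rnDeriv ν μ).ennreal_toNNReal
  have hae : (fun x => ((ν.rnDeriv μ x).toNNReal : ℝ≥0∞)) =ᵐ[μ] ν.rnDeriv μ := by
    filter_upwards [Measure.rnDeriv_lt_top ν μ] with x hx
    exact ENNReal.coe_toNNReal hx.ne
  have key : ∀ h : (ℕ → S) → ℝ≥0∞, Measurable h →
      ∫⁻ x, h x ∂ν = ∫⁻ x, ((ν.rnDeriv μ x).toNNReal : ℝ≥0∞) * h x ∂μ := by
    intro h hh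
    rw [← lintegral_rnDeriv_mul hac hh.aemeasurable]
    refine lintegral_congr_ae ?_
    filter_upwards [hae] with x hx
    rw [hx]
  refine ⟨_, hmm, ?_, ?_⟩
  · rw [← key _ hmm.coe_nnreal_ennreal]
    refine ((lintegral_mono' hle le_rfl).trans_lt ?_).ne
    have := key 1 measurable_one
    simp only [Pi.one_apply, mul_one, lintegral_one] at this
    rw [← this]
    exact measure_lt_top _ _
  · intro h hh
    rw [← key h hh, hν, lintegral_map hh measurable_T, ← lintegral_indicator hE]
    refine lintegral_congr fun x => ?_
    by_cases hx : x 0 ∈ A <;> simp [Set.indicator, hx]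

lemma density_inv (μ : Measure (ℕ → S)) 
    (hT : MeasurePreserving T μ μ) (h0 : MeasurePreserving (sw 0) μ μ)
    {A : Set S} (hA : MeasurableSet A) (m : (ℕ → S) → NNReal) (hm : Measurable m)
    (hfin : ∫⁻ x, (m x : ℝ≥0∞) * m x ∂μ ≠ ∞)
    (hd : ∀ h : (ℕ → S) → ℝ≥0∞, Measurable h →
        ∫⁻ x, A.indicator 1 (x 0) * h (T x) ∂μ = ∫⁻ x, (m x : ℝ≥0∞) * h x ∂μ) :
    (fun x => m (T x)) =ᵐ[μ] m := by
  have hmc : Measurable (fun x => (m x : ℝ≥0∞)) := hm.coe_nnreal_ennreal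
  have hmT : Measurable (fun x => (m (T x) : ℝ≥0∞)) := hmc.comp measurable_T
  have hmTT : Measurable (fun x => (m (T (T x)) : ℝ≥0∞)) := hmT.comp measurable_T
  have hind : Measurable (A.indicator (1 : S → ℝ≥0∞)) := measurable_one.indicator hA
  have hi : ∀ k : ℕ, Measurable (fun x : ℕ → S => A.indicator (1 : S → ℝ≥0∞) (x k)) :=
    fun k => hind.comp (measurable_pi_apply k)
  have p1 : Measurable (fun x : ℕ → S => A.indicator (1 : S → ℝ≥0∞) (x 0) * (m (T (T x)) : ℝ≥0∞)) :=
    (hi 0).mul hmTT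
  have p2 : Measurable (fun x : ℕ → S => A.indicator (1 : S → ℝ≥0∞) (x 0) * (m (T x) : ℝ≥0∞)) :=
    (hi 0).mul hmT
  have p3 : Measurable (fun x : ℕ → S => (m x : ℝ≥0∞) * (m (T x) : ℝ≥0∞)) := hmc.mul hmT
  have p4 : Measurable (fun x : ℕ → S => (m x : ℝ≥0∞) * (m x : ℝ≥0∞)) := hmc.mul hmc
  have e1 : ∫⁻ x, (m x : ℝ≥0∞) * m (T x) ∂μ = ∫⁻ x, (m x : ℝ≥0∞) * m x ∂μ := by
    rw [← hd _ hmT, ← hd _ hmc, ← h0.lintegral_comp p1,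
      ← hT.lintegral_comp p2]
    refine lintegral_congr fun x => ?_
    simp only [TT_sw_zero]
    simp [sw, T]
  have e2 : ∫⁻ x, (m (T x) : ℝ≥0∞) * m (T x) ∂μ = ∫⁻ x, (m x : ℝ≥0∞) * m x ∂μ :=
    hT.lintegral_comp (hmc.mul hmc)
  have hpt : ∀ a b : NNReal, a * b + a * b ≤ a * a + b * b := by
    intro a b
    have : (a : ℝ) * b + a * b ≤ a * a + b * b := by nlinarith [sq_nonneg ((a : ℝ) - b)]
    exact_mod_cast this
  have hae := ae_eq_of_ae_le_of_lintegral_le (μ := μ)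
    (f := fun x => (m x : ℝ≥0∞) * m (T x) + (m x : ℝ≥0∞) * m (T x))
    (g := fun x => (m x : ℝ≥0∞) * m x + (m (T x) : ℝ≥0∞) * m (T x))
    (Filter.Eventually.of_forall fun x => by
      beta_reduce
      exact_mod_cast hpt (m x) (m (T x)))
    (by
      rw [lintegral_add_left p3, e1]
      exact ENNReal.add_ne_top.2 ⟨hfin, hfin⟩)
    ((hmc.mul hmc).add (hmT.mul hmT)).aemeasurable
    (by rw [lintegral_add_left p3, lintegral_add_left p4, e1, e2])
  filter_upwards [hae] with x hx
  have hx' : m x * m (T x) + m x * m (T x) = m x * m x + m (T x) * m (T x) := by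
    exact_mod_cast hx
  have hr : (m x : ℝ) * m (T x) + m x * m (T x) = m x * m x + m (T x) * m (T x) := by
    exact_mod_cast hx'
  have : ((m (T x) : ℝ) - m x) ^ 2 = 0 := by linarith
  have := pow_eq_zero_iff (two_ne_zero) |>.1 this
  exact NNReal.coe_injective (by linarith)

lemma density_inv_iter (μ : Measure (ℕ → S)) (hT : MeasurePreserving T μ μ)
    (m : (ℕ → S) → NNReal) (h : (fun x => m (T x)) =ᵐ[μ] m) (k : ℕ) :
    (fun x => m ((T^[k]) x)) =ᵐ[μ] m := by
  induction k with
  | zero => rfl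
  | succ k ih =>
    have := hT.quasiMeasurePreserving.ae_eq_comp ih
    filter_upwards [this, h] with x h1 h2
    rw [Function.iterate_succ_apply]
    exact h1.trans h2

lemma step (μ : Measure (ℕ → S)) [IsProbabilityMeasure μ]
    (hT : MeasurePreserving T μ μ) (h0 : MeasurePreserving (sw 0) μ μ)
    (j : ℕ) (hj : MeasurePreserving (sw j) μ μ) : MeasurePreserving (sw (j + 1)) μ μ := by
  refine ⟨measurable_sw _, ?_⟩
  have hpair : Measurable (fun x : ℕ → S => (x 0, T x)) :=
    (measurable_pi_apply 0).prodMk measurable_T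
  -- equality of the laws of the pairs
  have hp : (μ.map (sw (j + 1))).map (fun x => (x 0, T x)) = μ.map (fun x => (x 0, T x)) := by
    have : IsProbabilityMeasure (μ.map (sw (j + 1))) :=
      Measure.isProbabilityMeasure_map (measurable_sw _).aemeasurable
    have : IsProbabilityMeasure ((μ.map (sw (j + 1))).map (fun x => (x 0, T x))) :=
      Measure.isProbabilityMeasure_map hpair.aemeasurable
    refine Measure.ext_prod fun {A B} hA hB => ?_
    obtain ⟨m, hm, hfin, hd⟩ := exists_density μ hT hA
    have hinv := density_inv_iter μ hT m (density_inv μ hT h0 hA m hm hfin hd) (j + 2)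
    have hb : Measurable (B.indicator (1 : (ℕ → S) → ℝ≥0∞)) := measurable_one.indicator hB
    have main : ∫⁻ x, A.indicator 1 (x 0) * B.indicator 1 (sw j (T x)) ∂μ
        = ∫⁻ x, A.indicator 1 (x 0) * (B.indicator 1 (T x) : ℝ≥0∞) ∂μ := by
      have hms : Measurable (fun x => (m ((T^[j + 2]) x) : ℝ≥0∞)) :=
        hm.coe_nnreal_ennreal.comp (measurable_T.iterate _)
      rw [hd _ hb, hd (fun x => B.indicator 1 (sw j x)) (hb.comp (measurable_sw j))]
      have a1 : ∀ h : (ℕ → S) → ℝ≥0∞, ∫⁻ x, (m x : ℝ≥0∞) * h x ∂μ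
          = ∫⁻ x, (m ((T^[j + 2]) x) : ℝ≥0∞) * h x ∂μ := by
        intro h
        refine lintegral_congr_ae ?_
        filter_upwards [hinv] with x hx
        rw [hx]
      have p : Measurable (fun x => (m ((T^[j + 2]) x) : ℝ≥0∞) * B.indicator 1 x) := hms.mul hb
      rw [a1, a1, ← hj.lintegral_comp p]
      refine lintegral_congr fun x => ?_
      simp only [T_iter_sw]
    have e : ∀ x : ℕ → S, ∀ y : ℕ → S, A.indicator 1 (x 0) * (B.indicator 1 y : ℝ≥0∞)
        = (A ×ˢ B).indicator 1 (x 0, y) := by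
      intro x y
      by_cases h1 : x 0 ∈ A <;> by_cases h2 : y ∈ B <;> simp [Set.indicator, h1, h2]
    simp only [e] at main
    have p : Measurable (fun x : ℕ → S => (A ×ˢ B).indicator (1 : S × (ℕ → S) → ℝ≥0∞) (x 0, T x)) :=
      (measurable_one.indicator (hA.prod hB)).comp hpair
    rw [← lintegral_indicator_one (hA.prod hB), ← lintegral_indicator_one (hA.prod hB),
      lintegral_map (measurable_one.indicator (hA.prod hB)) hpair,
      lintegral_map (measurable_one.indicator (hA.prod hB)) hpair,
      lintegral_map p (measurable_sw _)]
    simp only [T_sw_succ, sw_succ_zero]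
    exact main
  -- reassemble
  let c : S × (ℕ → S) → ℕ → S := fun p i => Nat.casesOn i p.1 p.2
  have hc : Measurable c := by
    refine measurable_pi_lambda _ fun i => ?_
    cases i with
    | zero => exact measurable_fst
    | succ i => exact (measurable_pi_apply i).comp measurable_snd
  have hid : c ∘ (fun x : ℕ → S => (x 0, T x)) = id := by
    funext x i
    cases i <;> rfl
  have := congrArg (Measure.map c) hp
  rwa [Measure.map_map hc hpair, Measure.map_map hc hpair, hid, Measure.map_id,
    Measure.map_id] at this

end SwapAux

/-- If an infinite stationary sequence in a standard Borel space has a law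
invariant under transposing the first two coordinates, then its law is invariant under every
adjacent transposition of coordinates. -/
theorem map_adjacent_swap_of_stationary_of_swap_first_two
    {Ω S : Type*} [MeasurableSpace Ω] [MeasurableSpace S] [StandardBorelSpace S]
    (P : Measure Ω) [IsProbabilityMeasure P] (ξ : ℕ → Ω → S)
    (hmeas : ∀ i, Measurable (ξ i)) (hstat : Stationary P ξ)
    (hswap01 : Measure.map (fun ω (i : ℕ) => ξ (Equiv.swap 0 1 i) ω) P
      = Measure.map (fun ω (i : ℕ) => ξ i ω) P) :
    ∀ j : ℕ, Measure.map (fun ω (i : ℕ) => ξ (Equiv.swap j (j + 1) i) ω) P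
      = Measure.map (fun ω (i : ℕ) => ξ i ω) P := by
  have hξ : Measurable (fun ω (i : ℕ) => ξ i ω) := measurable_pi_lambda _ hmeas
  set μ : Measure (ℕ → S) := Measure.map (fun ω (i : ℕ) => ξ i ω) P with hμ
  have : IsProbabilityMeasure μ := Measure.isProbabilityMeasure_map hξ.aemeasurable
  have hT : MeasurePreserving SwapAux.T μ μ :=
    ⟨SwapAux.measurable_T, by
      rw [hμ, Measure.map_map SwapAux.measurable_T hξ]
      exact hstat⟩
  have h0 : MeasurePreserving (SwapAux.sw 0) μ μ :=
    ⟨SwapAux.measurable_sw 0, by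
      rw [hμ, Measure.map_map (SwapAux.measurable_sw 0) hξ]
      exact hswap01⟩
  have hall : ∀ j, MeasurePreserving (SwapAux.sw j) μ μ := by
    intro j
    induction j with
    | zero => exact h0
    | succ j ih => exact SwapAux.step μ hT h0 j ih
  intro j
  have := (hall j).map_eq
  rw [hμ, Measure.map_map (SwapAux.measurable_sw j) hξ] at this
  exact this
end

section
/- Let ξ = (ξ_1, ξ_2, …) be an infinite homogeneous Markov sequence with values in a standard Borel space S, with empirical distributions η_n = n⁻¹ ∑_{i=1}^n δ_{ξ_i}. If η is a reverse measure-valued martingale with respect to the tail σ-fields 𝒯_n = σ(η_n, η_{n+1}, …), then ξ is exchangeable. -/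
open MeasureTheory ProbabilityTheory
open scoped ENNReal

section Aux

variable {Ω S : Type*} [MeasurableSpace Ω] [MeasurableSpace S]

lemma aux_integral_empDist (ξ : ℕ → Ω → S) (n : ℕ) (ω : Ω) {f : S → ℝ} (hf : Measurable f) :
    ∫ x, f x ∂(empDist ξ n ω) = (n : ℝ)⁻¹ * ∑ i ∈ Finset.range n, f (ξ i ω) := by
  unfold empDist
  rw [integral_smul_measure, integral_finsetSum_measure]
  · simp only [integral_dirac' _ _ hf.stronglyMeasurable]
    simp
  · intro i _
    exact (integrable_dirac' hf.stronglyMeasurable (by simp))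

lemma aux_empDist_apply (ξ : ℕ → Ω → S) (n : ℕ) (ω : Ω) {A : Set S} (hA : MeasurableSet A) :
    (n : ℝ≥0∞) * empDist ξ n ω A = ∑ i ∈ Finset.range n, A.indicator 1 (ξ i ω) := by
  unfold empDist
  rcases Nat.eq_zero_or_pos n with rfl | hn
  · simp
  · rw [Measure.smul_apply, Measure.finsetSum_apply, smul_eq_mul, ← mul_assoc,
      ENNReal.mul_inv_cancel (by simp; omega) (by simp), one_mul]
    simp [Measure.dirac_apply' _ hA]

lemma aux_tailField_le {ξ : ℕ → Ω → S} (hmeas : ∀ i, Measurable (ξ i)) (n : ℕ) :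
    tailField ξ n ≤ ‹MeasurableSpace Ω› := by
  refine iSup_le fun k => iSup_le fun _ => ?_
  refine Measurable.comap_le ?_
  refine Measure.measurable_of_measurable_coe _ fun A hA => ?_
  unfold empDist
  simp only [Measure.smul_apply, Measure.finsetSum_apply, smul_eq_mul]
  refine Measurable.const_mul ?_ _
  refine Finset.measurable_sum _ fun i _ => ?_
  exact (Measure.measurable_coe hA).comp (Measure.measurable_dirac.comp (hmeas i))

lemma aux_tailField_anti (ξ : ℕ → Ω → S) {m n : ℕ} (h : m ≤ n) :
    tailField ξ n ≤ tailField ξ m :=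
  iSup_le fun k => iSup_le fun hk => le_iSup₂_of_le k (h.trans hk) le_rfl

/-- counts are tail measurable -/
lemma aux_count_meas (ξ : ℕ → Ω → S) {n k : ℕ} (hk : n ≤ k) {A : Set S} (hA : MeasurableSet A) :
    Measurable[tailField ξ n]
      (fun ω => ∑ i ∈ Finset.range k, A.indicator (1 : S → ℝ≥0∞) (ξ i ω)) := by
  have h1 : Measurable[tailField ξ n] (empDist ξ k) := by
    rw [measurable_iff_comap_le]
    exact le_iSup₂_of_le k hk le_rfl
  have h2 : Measurable[tailField ξ n] (fun ω => (k : ℝ≥0∞) * empDist ξ k ω A) :=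
    ((Measure.measurable_coe hA).comp h1).const_mul _
  simpa only [aux_empDist_apply ξ k _ hA] using h2

lemma aux_last_meas (ξ : ℕ → Ω → S) (n : ℕ) {A : Set S} (hA : MeasurableSet A) :
    MeasurableSet[tailField ξ n] {ω | ξ n ω ∈ A} := by
  have h1 := aux_count_meas ξ (le_refl n) hA
  have h2 := aux_count_meas ξ (Nat.le_succ n) hA
  have : {ω | ξ n ω ∈ A} = {ω | (∑ i ∈ Finset.range n, A.indicator (1 : S → ℝ≥0∞) (ξ i ω)) <
      ∑ i ∈ Finset.range (n + 1), A.indicator (1 : S → ℝ≥0∞) (ξ i ω)} := by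
    ext ω
    simp only [Set.mem_ofPred_eq, Finset.sum_range_succ]
    by_cases h : ξ n ω ∈ A
    · simp only [h, true_iff, Set.indicator_of_mem, Pi.one_apply]
      refine ENNReal.lt_add_right ?_ (by simp)
      refine ENNReal.sum_ne_top.2 fun i _ => ?_
      by_cases h' : ξ i ω ∈ A <;> simp [h']
    · simp [h]
  rw [this]
  exact measurableSet_lt h1 h2

lemma aux_key (P : Measure Ω) [IsProbabilityMeasure P] {ξ : ℕ → Ω → S}
    (hmeas : ∀ i, Measurable (ξ i)) (hmart : IsReverseMVM P ξ) (n : ℕ)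
    {A : Set S} (hA : MeasurableSet A) {D : Set Ω} (hD : MeasurableSet[tailField ξ (n + 1)] D) :
    ((n : ℝ) + 1) * ∫ ω in D, A.indicator (1 : S → ℝ) (ξ n ω) ∂P
      = ∫ ω in D, ∑ i ∈ Finset.range (n + 1), A.indicator (1 : S → ℝ) (ξ i ω) ∂P := by
  have hf : Measurable (A.indicator (1 : S → ℝ)) := measurable_one.indicator hA
  have hb : ∀ x, |A.indicator (1 : S → ℝ) x| ≤ 1 := by
    intro x; by_cases h : x ∈ A <;> simp [h]
  have hint : ∀ i, Integrable (fun ω => A.indicator (1 : S → ℝ) (ξ i ω)) P := fun i =>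
    Integrable.of_bound (hf.comp (hmeas i)).aestronglyMeasurable 1
      (Filter.Eventually.of_forall fun ω => hb _)
  have hsum : ∀ k, Integrable (fun ω => ∑ i ∈ Finset.range k, A.indicator (1 : S → ℝ) (ξ i ω)) P :=
    fun k => integrable_finsetSum _ fun i _ => hint i
  rcases Nat.eq_zero_or_pos n with rfl | hn
  · simp
  have h := hmart _ hf ⟨1, hb⟩ n (n + 1) hn (Nat.le_succ n)
  simp only [aux_integral_empDist ξ _ _ hf] at h
  have hle := aux_tailField_le hmeas (n + 1)
  have h3 := setIntegral_condExp (μ := P) hle ((hsum n).const_mul ((n : ℝ)⁻¹)) hD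
  rw [integral_congr_ae (ae_restrict_of_ae h), integral_const_mul, integral_const_mul] at h3
  simp only [Finset.sum_range_succ _ n] at h3 ⊢
  rw [integral_add (hsum n).integrableOn (hint n).integrableOn] at h3 ⊢
  have hn' : (n : ℝ) ≠ 0 := by positivity
  have hn1 : (n : ℝ) + 1 ≠ 0 := by positivity
  push_cast at h3
  field_simp at h3
  linarith

/-- The number of occurrences of `a` among the first `n` terms of `c`. -/
def auxN {K : Type*} [DecidableEq K] (c : ℕ → K) (n : ℕ) (a : K) : ℕ :=
  ∑ i ∈ Finset.range n, if c i = a then 1 else 0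

lemma auxN_succ {K : Type*} [DecidableEq K] (c : ℕ → K) (n : ℕ) (a : K) :
    auxN c (n + 1) a = auxN c n a + if c n = a then 1 else 0 := Finset.sum_range_succ _ _

variable {K : Type*} [Fintype K] [DecidableEq K] [MeasurableSpace K] [MeasurableSingletonClass K]

lemma aux_ind {R : Type*} [Zero R] [One R] (q : S → K) (a : K) (s : S) :
    (q ⁻¹' {a}).indicator (1 : S → R) s = if q s = a then 1 else 0 := by
  by_cases h : q s = a <;> simp [h]

lemma aux_cnt_meas (ξ : ℕ → Ω → S) {q : S → K} (hq : Measurable q) (n : ℕ) (v : K → ℕ) :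
    MeasurableSet[tailField ξ n] {ω | ∀ a, auxN (fun i => q (ξ i ω)) n a = v a} := by
  rw [Set.ofPred_forall]
  refine MeasurableSet.iInter fun a => ?_
  have h := aux_count_meas ξ (le_refl n) (hq (measurableSet_singleton a))
  have : {ω | auxN (fun i => q (ξ i ω)) n a = v a} =
      (fun ω => ∑ i ∈ Finset.range n, (q ⁻¹' {a}).indicator (1 : S → ℝ≥0∞) (ξ i ω)) ⁻¹'
        {(v a : ℝ≥0∞)} := by
    ext ω
    simp only [Set.mem_ofPred_eq, Set.mem_preimage, Set.mem_singleton_iff, aux_ind, auxN]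
    rw [← Nat.cast_inj (R := ℝ≥0∞)]
    push_cast
    rfl
  rw [this]
  exact h (measurableSet_singleton _)

lemma aux_main (P : Measure Ω) [IsProbabilityMeasure P] {ξ : ℕ → Ω → S}
    (hmeas : ∀ i, Measurable (ξ i)) (hmart : IsReverseMVM P ξ) {q : S → K} (hq : Measurable q)
    (c : ℕ → K) (n : ℕ) : ∀ B : Set Ω, MeasurableSet[tailField ξ n] B →
    (n.factorial : ℝ) * P.real ({ω | ∀ i < n, q (ξ i ω) = c i} ∩ B) =
      (∏ a, ((auxN c n a).factorial : ℝ)) *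
        P.real ({ω | ∀ a, auxN (fun i => q (ξ i ω)) n a = auxN c n a} ∩ B) := by
  induction n with
  | zero => intro B _; simp [auxN]
  | succ n ih =>
    intro B hB
    set L : Set Ω := {ω | ξ n ω ∈ q ⁻¹' {c n}} with hL
    have hLm : MeasurableSet[tailField ξ n] L := aux_last_meas ξ n (hq (measurableSet_singleton _))
    have hB' := aux_tailField_anti ξ (Nat.le_succ n) _ hB
    have h1 := ih (L ∩ B) (hLm.inter hB')
    have e1 : {ω | ∀ i < n + 1, q (ξ i ω) = c i} ∩ B =
        {ω | ∀ i < n, q (ξ i ω) = c i} ∩ (L ∩ B) := by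
      ext ω
      simp only [Set.mem_inter_iff, Set.mem_ofPred_eq, hL, Set.mem_preimage,
        Set.mem_singleton_iff, Nat.forall_lt_succ_right]
      tauto
    set D := {ω | ∀ a, auxN (fun i => q (ξ i ω)) (n + 1) a = auxN c (n + 1) a} ∩ B with hDdef
    have hD : MeasurableSet[tailField ξ (n + 1)] D := (aux_cnt_meas ξ hq (n + 1) _).inter hB
    have e2 : {ω | ∀ a, auxN (fun i => q (ξ i ω)) n a = auxN c n a} ∩ (L ∩ B) = L ∩ D := by
      ext ω
      simp only [hDdef, Set.mem_inter_iff, Set.mem_ofPred_eq, hL, Set.mem_preimage,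
        Set.mem_singleton_iff, auxN_succ]
      constructor
      · rintro ⟨h, h', h''⟩
        exact ⟨h', fun a => by rw [h a, h'], h''⟩
      · rintro ⟨h', h, h''⟩
        exact ⟨fun a => by have := h a; rw [h'] at this; omega, h', h''⟩
    have hk := aux_key P hmeas hmart n (hq (measurableSet_singleton (c n))) hD
    have hle := aux_tailField_le hmeas (n + 1)
    have hle' := aux_tailField_le hmeas n
    have k1 : ∫ ω in D, (q ⁻¹' {c n}).indicator (1 : S → ℝ) (ξ n ω) ∂P = P.real (L ∩ D) := by
      have : (fun ω => (q ⁻¹' {c n}).indicator (1 : S → ℝ) (ξ n ω)) = L.indicator 1 := by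
        ext ω; simp [aux_ind, Set.indicator_apply, hL]
      rw [this, integral_indicator_one (hle' _ hLm), measureReal_restrict_apply (hle' _ hLm)]
    have k2 : ∫ ω in D, ∑ i ∈ Finset.range (n + 1),
        (q ⁻¹' {c n}).indicator (1 : S → ℝ) (ξ i ω) ∂P = auxN c (n + 1) (c n) * P.real D := by
      rw [setIntegral_congr_fun (g := fun _ => (auxN c (n + 1) (c n) : ℝ)) (hle _ hD)]
      · simp [mul_comm]
      · intro ω hω
        have := hω.1 (c n)
        simp only [aux_ind]
        rw [← this, auxN]
        push_cast
        rfl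
    rw [k1, k2] at hk
    rw [e2] at h1
    rw [e1, Nat.factorial_succ]
    have hprod : (∏ a, ((auxN c (n + 1) a).factorial : ℝ)) =
        auxN c (n + 1) (c n) * ∏ a, ((auxN c n a).factorial : ℝ) := by
      rw [← Finset.mul_prod_erase _ _ (Finset.mem_univ (c n)),
        ← Finset.mul_prod_erase _ (fun a => ((auxN c n a).factorial : ℝ)) (Finset.mem_univ (c n)),
        Finset.prod_congr rfl (g := fun a => ((auxN c n a).factorial : ℝ))]
      · rw [auxN_succ, if_pos rfl, Nat.factorial_succ]
        push_cast
        ring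
      · intro a ha
        rw [auxN_succ, if_neg (Finset.ne_of_mem_erase ha).symm, add_zero]
    rw [hprod]
    push_cast
    linear_combination ((n : ℝ) + 1) * h1 + (∏ a, ((auxN c n a).factorial : ℝ)) * hk

lemma aux_perm (P : Measure Ω) [IsProbabilityMeasure P] {ξ : ℕ → Ω → S}
    (hmeas : ∀ i, Measurable (ξ i)) (hmart : IsReverseMVM P ξ) {q : S → K} (hq : Measurable q)
    (n : ℕ) (σ : Equiv.Perm (Fin n)) (c : Fin n → K) (k0 : K) :
    P {ω | ∀ i : Fin n, q (ξ i ω) = c i} = P {ω | ∀ i : Fin n, q (ξ i ω) = c (σ i)} := by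
  have key : ∀ c : Fin n → K, ∃ c' : ℕ → K, ∀ i : Fin n, c' i = c i := fun c =>
    ⟨fun i => if h : i < n then c ⟨i, h⟩ else k0, fun i => by simp⟩
  obtain ⟨c1, h1⟩ := key c
  obtain ⟨c2, h2⟩ := key (fun i => c (σ i))
  have hN : auxN c1 n = auxN c2 n := by
    ext a
    simp only [auxN, Finset.sum_range, h1, h2]
    exact (Equiv.sum_comp σ (fun i => if c i = a then 1 else 0)).symm
  have m1 := aux_main P hmeas hmart hq c1 n Set.univ MeasurableSet.univ
  have m2 := aux_main P hmeas hmart hq c2 n Set.univ MeasurableSet.univ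
  rw [hN, ← m2] at m1
  have m3 := mul_left_cancel₀ (by positivity) m1
  simp only [Set.inter_univ] at m3
  have s : ∀ (c : Fin n → K) (c' : ℕ → K), (∀ i : Fin n, c' i = c i) →
      {ω | ∀ i < n, q (ξ i ω) = c' i} = {ω | ∀ i : Fin n, q (ξ i ω) = c i} := by
    intro c c' h
    ext ω
    simp only [Set.mem_ofPred_eq, ← h]
    exact ⟨fun H i => H i i.2, fun H i hi => H ⟨i, hi⟩⟩
  rw [s c c1 h1, s _ c2 h2] at m3
  exact (measureReal_eq_measureReal_iff).1 m3

end Aux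

/-- If the empirical distributions of an infinite homogeneous Markov sequence
in a standard Borel space form a reverse measure-valued martingale, then the sequence is
exchangeable. -/
theorem exchangeable_of_homogeneousMarkov_of_isReverseMVM
    {Ω S : Type*} [MeasurableSpace Ω] [MeasurableSpace S] [StandardBorelSpace S]
    (P : Measure Ω) [IsProbabilityMeasure P] (ξ : ℕ → Ω → S)
    (hmeas : ∀ i, Measurable (ξ i)) (hMarkov : IsHomogeneousMarkov P ξ)
    (hmart : IsReverseMVM P ξ) :
    Exchangeable P ξ := by
  classical
  intro m k hk
  have hm1 : Measurable (fun ω (i : Fin m) => ξ (k i) ω) := measurable_pi_lambda _ fun i => hmeas _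
  have hm2 : Measurable (fun ω (i : Fin m) => ξ (i : ℕ) ω) := measurable_pi_lambda _ fun i => hmeas _
  have := Measure.isProbabilityMeasure_map (μ := P) hm1.aemeasurable
  have := Measure.isProbabilityMeasure_map (μ := P) hm2.aemeasurable
  refine ext_of_generate_finite _ generateFrom_pi.symm isPiSystem_pi ?_ (by simp)
  rintro _ ⟨A, hA, rfl⟩
  have hA' : ∀ i, MeasurableSet (A i) := fun i => hA i (Set.mem_univ i)
  have hAm : MeasurableSet (Set.univ.pi A) := MeasurableSet.univ_pi hA'
  rw [Measure.map_apply hm1 hAm, Measure.map_apply hm2 hAm]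
  obtain ⟨n, hmn, hkn⟩ : ∃ n, m ≤ n ∧ ∀ i, k i < n := by
    refine ⟨m + ∑ i, (k i + 1), by omega, fun i => ?_⟩
    have := Finset.single_le_sum (f := fun i => k i + 1) (fun _ _ => Nat.zero_le _)
      (Finset.mem_univ i)
    omega
  let k1 : Fin m → Fin n := fun i => ⟨k i, hkn i⟩
  let k2 : Fin m → Fin n := Fin.castLE hmn
  have hk1 : Function.Injective k1 := fun i j h => hk (by simpa [k1] using h)
  have hk2 : Function.Injective k2 := Fin.castLE_injective hmn
  obtain ⟨σ, hσ⟩ : ∃ σ : Equiv.Perm (Fin n), ∀ i, σ (k2 i) = k1 i := by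
    let e : {x // x ∈ Set.range k2} ≃ {x // x ∈ Set.range k1} :=
      (Equiv.ofInjective k2 hk2).symm.trans (Equiv.ofInjective k1 hk1)
    refine ⟨e.extendSubtype, fun i => ?_⟩
    rw [Equiv.extendSubtype_apply_of_mem e _ ⟨i, rfl⟩]
    have : (Equiv.ofInjective k2 hk2).symm ⟨k2 i, ⟨i, rfl⟩⟩ = i := by
      rw [Equiv.symm_apply_eq]; rfl
    simp [e, this]
  let q : S → (Fin m → Bool) := fun s j => decide (s ∈ A j)
  have hq : Measurable q := by
    refine measurable_pi_lambda _ fun j => ?_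
    refine measurable_to_bool ?_
    have : (fun s => decide (s ∈ A j)) ⁻¹' {true} = A j := by ext s; simp
    rw [this]; exact hA' j
  let Y : Ω → (Fin n → Fin m → Bool) := fun ω i => q (ξ i ω)
  have hY : Measurable Y := measurable_pi_lambda _ fun i => hq.comp (hmeas _)
  have hYσ : Measurable (fun ω i => Y ω (σ i)) := measurable_pi_lambda _ fun i => hq.comp (hmeas _)
  have hlaw : Measure.map (fun ω i => Y ω (σ i)) P = Measure.map Y P := by
    refine Measure.ext_of_singleton fun c => ?_
    rw [Measure.map_apply hYσ (measurableSet_singleton _),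
      Measure.map_apply hY (measurableSet_singleton _)]
    have := aux_perm P hmeas hmart hq n σ.symm c (fun _ => true)
    convert this.symm using 2
    · ext ω
      simp only [Set.mem_preimage, Set.mem_singleton_iff, Set.mem_ofPred_eq, funext_iff (f := fun i => Y ω (σ i))]
      constructor
      · intro h i; have := h (σ.symm i); simpa [Y] using this
      · intro h i; have := h (σ i); simpa [Y] using this
    · ext ω
      simp only [Set.mem_preimage, Set.mem_singleton_iff, Set.mem_ofPred_eq, funext_iff (f := Y ω)]
      rfl
  let C : Set (Fin n → Fin m → Bool) := {c | ∀ i, c (k2 i) i = true}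
  have hC : MeasurableSet C := MeasurableSet.of_discrete
  have := congrArg (fun μ => μ C) hlaw
  simp only [Measure.map_apply hYσ hC, Measure.map_apply hY hC] at this
  convert this using 2
  · ext ω; simp [C, Y, q, hσ, k1]
  · ext ω; simp [C, Y, q, k2]
end

section
/- Let X : ℕ × ℕ → S be an infinite random matrix with values in a standard Borel space S. For each n, m ≥ 1, define the column vectors Y^n_j = (X_{1,j}, …, X_{n,j}) ∈ S^n and row vectors Z^m_i = (X_{i,1}, …, X_{i,m}) ∈ S^m, with joint empirical distributions η^n_m = m⁻¹ ∑_{j ≤ m} δ_{Y^n_j} (measures on S^n) and η^m_n = n⁻¹ ∑_{i ≤ n} δ_{Z^m_i} (measures on S^m). Then X is separately exchangeable if and only if for every n the family (η^n_m)_m and for every m the family (η^m_n)_n are reverse measure-valued martingales (with respect to their respective tail σ-fields), and for every n, m the sequences (Y^n_j)_{j ≥ 1} and (Z^m_i)_{i ≥ 1} are stationary. -/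
open MeasureTheory ProbabilityTheory
open scoped ENNReal

/-- The empirical distribution `η_{n,m} = (nm)⁻¹ ∑_{i ≤ n} ∑_{j ≤ m} δ_{X_{i,j}}` of the upper
left `n × m` corner of the random matrix `X` (indexed from `0`). -/
noncomputable def empDist2 {Ω S : Type*} [MeasurableSpace S] (X : ℕ → ℕ → Ω → S)
    (n m : ℕ) (ω : Ω) : Measure S :=
  ((n * m : ℕ) : ℝ≥0∞)⁻¹ •
    ∑ i ∈ Finset.range n, ∑ j ∈ Finset.range m, Measure.dirac (X i j ω)

/-- The σ-field `𝒯_{n,m} = σ(η_{u,v} : u ≥ n, v ≥ m)`. -/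
noncomputable def tailField2 {Ω S : Type*} [MeasurableSpace S] (X : ℕ → ℕ → Ω → S)
    (n m : ℕ) : MeasurableSpace Ω :=
  ⨆ u, ⨆ _ : n ≤ u, ⨆ v, ⨆ _ : m ≤ v, MeasurableSpace.comap (empDist2 X u v) inferInstance

/-- `η_{·,·}` is a reverse measure-valued martingale on `ℕ²`: for bounded measurable `f` and
all `1 ≤ k ≤ n`, `1 ≤ l ≤ m`, `E[η_{k,l} f | 𝒯_{n,m}] = η_{n,m} f` a.s. -/
def IsReverseMVM2 {Ω S : Type*} [MeasurableSpace Ω] [MeasurableSpace S]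
    (P : Measure Ω) (X : ℕ → ℕ → Ω → S) : Prop :=
  ∀ f : S → ℝ, Measurable f → (∃ C, ∀ x, |f x| ≤ C) →
    ∀ k l n m : ℕ, 1 ≤ k → k ≤ n → 1 ≤ l → l ≤ m →
      P[(fun ω => ∫ x, f x ∂(empDist2 X k l ω)) | tailField2 X n m]
        =ᵐ[P] fun ω => ∫ x, f x ∂(empDist2 X n m ω)

/-- `X` is separately exchangeable: its law is invariant under arbitrary permutations of the
rows and of the columns. -/
def SepExchangeable {Ω S : Type*} [MeasurableSpace Ω] [MeasurableSpace S]
    (P : Measure Ω) (X : ℕ → ℕ → Ω → S) : Prop :=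
  ∀ p q : Equiv.Perm ℕ,
    Measure.map (fun ω (ij : ℕ × ℕ) => X (p ij.1) (q ij.2) ω) P
      = Measure.map (fun ω (ij : ℕ × ℕ) => X ij.1 ij.2 ω) P

namespace SepExchAux

lemma measurable_empDist {Ω S : Type*} [MeasurableSpace Ω] [MeasurableSpace S]
    (ξ : ℕ → Ω → S) (hξ : ∀ i, Measurable (ξ i)) (n : ℕ) : Measurable (empDist ξ n) := by
  refine Measure.measurable_of_measurable_coe _ fun s hs => ?_
  simp only [empDist, Measure.smul_apply, Measure.finsetSum_apply, smul_eq_mul]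
  refine Measurable.const_mul ?_ _
  refine Finset.measurable_fun_sum _ fun i _ => ?_
  exact (Measure.measurable_coe hs).comp (Measure.measurable_dirac.comp (hξ i))

lemma tailField_le {Ω S : Type*} [m : MeasurableSpace Ω] [MeasurableSpace S]
    (ξ : ℕ → Ω → S) (hξ : ∀ i, Measurable (ξ i)) (n : ℕ) : tailField ξ n ≤ m :=
  iSup_le fun k => iSup_le fun _ => (measurable_empDist ξ hξ k).comap_le

lemma tailField_anti {Ω S : Type*} [MeasurableSpace S]
    (ξ : ℕ → Ω → S) {m n : ℕ} (h : m ≤ n) : tailField ξ n ≤ tailField ξ m :=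
  iSup_le fun k => iSup_le fun hk => le_iSup_of_le k (le_iSup_of_le (h.trans hk) le_rfl)

lemma empDist_tail {Ω S : Type*} [MeasurableSpace S]
    (ξ : ℕ → Ω → S) {m n : ℕ} (h : m ≤ n) : Measurable[tailField ξ m] (empDist ξ n) := by
  refine Measurable.of_comap_le ?_
  exact le_iSup_of_le n (le_iSup_of_le h le_rfl)

lemma integral_empDist {Ω S : Type*} [MeasurableSpace S]
    (ξ : ℕ → Ω → S) (f : S → ℝ) (hf : Measurable f) (n : ℕ) (ω : Ω) :
    ∫ x, f x ∂(empDist ξ n ω) = (n : ℝ)⁻¹ * ∑ i ∈ Finset.range n, f (ξ i ω) := by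
  have hi : ∀ i ∈ Finset.range n, Integrable f (Measure.dirac (ξ i ω)) := by
    intro i _
    refine ⟨hf.aestronglyMeasurable, ?_⟩
    rw [HasFiniteIntegral, lintegral_dirac' _ (by fun_prop)]
    exact ENNReal.coe_lt_top
  rw [empDist, integral_smul_measure, integral_finsetSum_measure hi]
  simp only [smul_eq_mul, ENNReal.toReal_inv, ENNReal.toReal_natCast]
  congr 1
  exact Finset.sum_congr rfl fun i _ => integral_dirac' _ _ hf.stronglyMeasurable

/-- sums of nonnegative measurable functions over the first `n` are tail measurable -/
lemma measurable_sum_nonneg {Ω S : Type*} [MeasurableSpace S]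
    (ξ : ℕ → Ω → S) (f : S → ℝ) (hf : Measurable f) (h0 : ∀ x, 0 ≤ f x) {m n : ℕ} (h : m ≤ n) :
    Measurable[tailField ξ m] (fun ω => ∑ i ∈ Finset.range n, f (ξ i ω)) := by
  have h1 : (fun ω => ∑ i ∈ Finset.range n, f (ξ i ω)) =
      fun ω => ((n : ℝ≥0∞) * ∫⁻ x, ENNReal.ofReal (f x) ∂(empDist ξ n ω)).toReal := by
    funext ω
    rw [empDist, lintegral_smul_measure, lintegral_finsetSum_measure]
    simp_rw [lintegral_dirac' _ hf.ennreal_ofReal]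
    rcases Nat.eq_zero_or_pos n with rfl | hn
    · simp
    · rw [smul_eq_mul, ← mul_assoc, ENNReal.mul_inv_cancel (by simp; omega) (by simp), one_mul,
        ← ENNReal.ofReal_sum_of_nonneg (fun i _ => h0 _),
        ENNReal.toReal_ofReal (Finset.sum_nonneg fun i _ => h0 _)]
  rw [h1]
  have h2 := (Measure.measurable_lintegral hf.ennreal_ofReal).comp (empDist_tail ξ h)
  exact ((measurable_const.mul measurable_id).comp h2).ennreal_toReal

lemma measurable_tail_coord {Ω S : Type*} [MeasurableSpace S]
    (ξ : ℕ → Ω → S) {m j : ℕ} (h : m ≤ j) : Measurable[tailField ξ m] (ξ j) := by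
  intro A hA
  have hf : Measurable (A.indicator (fun _ => (1 : ℝ))) := measurable_const.indicator hA
  have h0 : ∀ x, 0 ≤ A.indicator (fun _ => (1 : ℝ)) x :=
    fun x => Set.indicator_nonneg (fun _ _ => zero_le_one) x
  have h1 := measurable_sum_nonneg ξ _ hf h0 (h.trans (Nat.le_succ j))
  have h2 := measurable_sum_nonneg ξ _ hf h0 h
  have h3 : Measurable[tailField ξ m] (fun ω => A.indicator (fun _ => (1 : ℝ)) (ξ j ω)) := by
    have h4 : (fun ω => A.indicator (fun _ => (1 : ℝ)) (ξ j ω)) =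
        fun ω => ∑ i ∈ Finset.range j.succ, A.indicator (fun _ => (1 : ℝ)) (ξ i ω) -
          ∑ i ∈ Finset.range j, A.indicator (fun _ => (1 : ℝ)) (ξ i ω) := by
      funext ω
      rw [Finset.sum_range_succ]
      ring
    rw [h4]
    exact Measurable.sub h1 h2
  have : ξ j ⁻¹' A = (fun ω => A.indicator (fun _ => (1 : ℝ)) (ξ j ω)) ⁻¹' {1} := by
    ext ω
    by_cases hω : ξ j ω ∈ A <;> simp [hω]
  rw [this]
  exact h3 (measurableSet_singleton 1)

/-- bounded and tail measurable -/
def BddMeas {Ω : Type*} (m : MeasurableSpace Ω) (H : Ω → ℝ) : Prop :=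
  Measurable[m] H ∧ ∃ C, ∀ ω, |H ω| ≤ C

/-- `[0,1]`-valued measurable -/
def Good {S : Type*} [MeasurableSpace S] (f : S → ℝ) : Prop :=
  Measurable f ∧ ∀ x, 0 ≤ f x ∧ f x ≤ 1

lemma BddMeas.mul {Ω : Type*} {m : MeasurableSpace Ω} {H G : Ω → ℝ} (hH : BddMeas m H)
    (hG : BddMeas m G) : BddMeas m (fun ω => H ω * G ω) := by
  obtain ⟨C, hC⟩ := hH.2
  obtain ⟨D, hD⟩ := hG.2
  refine ⟨hH.1.mul hG.1, C * D, fun ω => ?_⟩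
  rw [abs_mul]
  exact mul_le_mul (hC ω) (hD ω) (abs_nonneg _) ((abs_nonneg _).trans (hC ω))

lemma BddMeas.sum {Ω ι : Type*} {m : MeasurableSpace Ω} {H : ι → Ω → ℝ} (s : Finset ι)
    (hH : ∀ i ∈ s, BddMeas m (H i)) : BddMeas m (fun ω => ∑ i ∈ s, H i ω) := by
  refine ⟨Finset.measurable_fun_sum _ fun i hi => (hH i hi).1, ?_⟩
  choose! C hC using fun i hi => (hH i hi).2
  exact ⟨∑ i ∈ s, C i, fun ω => (Finset.abs_sum_le_sum_abs _ _).trans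
    (Finset.sum_le_sum fun i hi => hC i hi ω)⟩

lemma BddMeas.mono {Ω : Type*} {m m' : MeasurableSpace Ω} {H : Ω → ℝ} (hH : BddMeas m H)
    (h : m ≤ m') : BddMeas m' H := ⟨hH.1.mono h le_rfl, hH.2⟩

lemma BddMeas.one {Ω : Type*} {m : MeasurableSpace Ω} : BddMeas m (fun _ => 1) :=
  ⟨measurable_const, 1, by simp⟩

lemma BddMeas.integrable {Ω : Type*} {m : MeasurableSpace Ω} {P : Measure Ω} [IsFiniteMeasure P]
    {H : Ω → ℝ} (hH : BddMeas m H) : Integrable H P := by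
  obtain ⟨C, hC⟩ := hH.2
  exact Integrable.of_bound hH.1.aestronglyMeasurable C (ae_of_all _ hC)

lemma Good.bddMeas {Ω S : Type*} [MeasurableSpace S] {m : MeasurableSpace Ω} {f : S → ℝ}
    (hf : Good f) {X : Ω → S} (hX : Measurable[m] X) : BddMeas m (fun ω => f (X ω)) :=
  ⟨hf.1.comp hX, 1, fun ω => by rw [abs_of_nonneg (hf.2 _).1]; exact (hf.2 _).2⟩

lemma Good.mul {S : Type*} [MeasurableSpace S] {f g : S → ℝ}
    (hf : Good f) (hg : Good g) : Good (f * g) :=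
  ⟨hf.1.mul hg.1, fun x => ⟨mul_nonneg (hf.2 x).1 (hg.2 x).1,
    mul_le_one₀ (hf.2 x).2 (hg.2 x).1 (hg.2 x).2⟩⟩

lemma BddMeas.prod {Ω : Type*} {m : MeasurableSpace Ω} : ∀ {k : ℕ} {H : Fin k → Ω → ℝ},
    (∀ i, BddMeas m (H i)) → BddMeas m (fun ω => ∏ i, H i ω)
  | 0, _, _ => by simpa using BddMeas.one
  | k + 1, H, hH => by
    simp_rw [Fin.prod_univ_succ]
    exact (hH 0).mul (BddMeas.prod fun i => hH i.succ)

lemma Good.bddMeas_sum {Ω S : Type*} [MeasurableSpace S] {f : S → ℝ}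
    (hf : Good f) (ξ : ℕ → Ω → S) {m n : ℕ} (h : m ≤ n) :
    BddMeas (tailField ξ m) (fun ω => ∑ i ∈ Finset.range n, f (ξ i ω)) := by
  refine ⟨measurable_sum_nonneg ξ f hf.1 (fun x => (hf.2 x).1) h, n, fun ω => ?_⟩
  rw [abs_of_nonneg (Finset.sum_nonneg fun i _ => (hf.2 _).1)]
  exact (Finset.sum_le_sum fun i _ => (hf.2 (ξ i ω)).2).trans (by simp)

lemma one_step {Ω S : Type*} [MeasurableSpace Ω] [MeasurableSpace S]
    (P : Measure Ω) [IsProbabilityMeasure P] (ξ : ℕ → Ω → S) (hξ : ∀ i, Measurable (ξ i))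
    (hR : IsReverseMVM P ξ) (d : ℕ) (G : Ω → ℝ) (hG : BddMeas (tailField ξ (d + 1)) G)
    (f : S → ℝ) (hf : Good f) :
    ((d + 1 : ℕ) : ℝ) * ∫ ω, G ω * f (ξ d ω) ∂P =
      ∫ ω, G ω * ∑ j ∈ Finset.range (d + 1), f (ξ j ω) ∂P := by
  have hle := tailField_le ξ hξ (d + 1)
  have hS : ∀ n, Integrable (fun ω => ∑ j ∈ Finset.range n, f (ξ j ω)) P := fun n =>
    (BddMeas.sum _ fun i _ => hf.bddMeas (hξ i)).integrable
  have hGS : ∀ n, Integrable (fun ω => G ω * ∑ j ∈ Finset.range n, f (ξ j ω)) P := fun n =>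
    ((hG.mono hle).mul (BddMeas.sum _ fun i _ => hf.bddMeas (hξ i))).integrable
  have hGf : Integrable (fun ω => G ω * f (ξ d ω)) P :=
    ((hG.mono hle).mul (hf.bddMeas (hξ d))).integrable
  have key : ∫ ω, G ω * ∑ j ∈ Finset.range (d + 1), f (ξ j ω) ∂P =
      ∫ ω, G ω * ∑ j ∈ Finset.range d, f (ξ j ω) ∂P + ∫ ω, G ω * f (ξ d ω) ∂P := by
    rw [← integral_add (hGS d) hGf]
    simp_rw [Finset.sum_range_succ, mul_add]
  rcases Nat.eq_zero_or_pos d with rfl | hd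
  · simp
  have hc := hR f hf.1 ⟨1, fun x => by rw [abs_of_nonneg (hf.2 _).1]; exact (hf.2 _).2⟩
    d (d + 1) hd (Nat.le_succ d)
  simp_rw [integral_empDist ξ f hf.1] at hc
  obtain ⟨C, hC⟩ := hG.2
  have h1 := condExp_stronglyMeasurable_mul_of_bound hle hG.1.stronglyMeasurable
    ((hS d).const_mul ((d : ℝ)⁻¹)) C (ae_of_all P hC)
  have h2 := integral_condExp hle (μ := P)
    (f := G * fun ω => (d : ℝ)⁻¹ * ∑ j ∈ Finset.range d, f (ξ j ω))
  have h3 : ∫ ω, G ω * ((d : ℝ)⁻¹ * ∑ j ∈ Finset.range d, f (ξ j ω)) ∂P =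
      ∫ ω, G ω * (((d + 1 : ℕ) : ℝ)⁻¹ * ∑ j ∈ Finset.range (d + 1), f (ξ j ω)) ∂P := by
    rw [show (∫ ω, G ω * ((d : ℝ)⁻¹ * ∑ j ∈ Finset.range d, f (ξ j ω)) ∂P) = _ from h2.symm]
    refine integral_congr_ae ?_
    filter_upwards [h1, hc] with ω e1 e2
    rw [e1, Pi.mul_apply, e2]
  simp_rw [mul_left_comm (G _)] at h3
  rw [integral_const_mul, integral_const_mul] at h3
  have hd' : (d : ℝ) ≠ 0 := by positivity
  push_cast at h3 ⊢
  field_simp at h3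
  linear_combination (-(d:ℝ)-1) * key - h3

lemma emb_sum {n k : ℕ} (x : Fin n → ℝ) (y : Fin k → Fin n → ℝ) :
    ∑ g : Fin (k + 1) ↪ Fin n, x (g 0) * ∏ a : Fin k, y a (g a.succ) =
      ∑ g : Fin k ↪ Fin n, (∏ a, y a (g a)) * (∑ j, x j - ∑ a, x (g a)) := by
  rw [← (Equiv.embeddingFinSucc k (Fin n)).symm.sum_comp, Fintype.sum_sigma]
  refine Finset.sum_congr rfl fun g _ => ?_
  simp only [Equiv.coe_embeddingFinSucc_symm, Fin.cons_zero, Fin.cons_succ]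
  rw [← Finset.sum_mul, mul_comm]
  congr 1
  rw [eq_sub_iff_add_eq]
  have h1 : ∑ a, x (g a) = ∑ j ∈ Finset.univ.filter (fun j => j ∈ Set.range g), x j := by
    rw [← Finset.sum_map Finset.univ g x]
    refine Finset.sum_congr ?_ fun _ _ => rfl
    ext; simp
  have h2 : ∑ i : {i // i ∉ Set.range g}, x i =
      ∑ j ∈ Finset.univ.filter (fun j => ¬ j ∈ Set.range g), x j := by
    exact (Finset.sum_subtype _ (by intro; simp) x).symm
  rw [h1, h2, add_comm, Finset.sum_filter_add_sum_filter_not]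

lemma key_id {Ω S : Type*} [MeasurableSpace Ω] [MeasurableSpace S]
    (P : Measure Ω) [IsProbabilityMeasure P] (ξ : ℕ → Ω → S) (hξ : ∀ i, Measurable (ξ i))
    (hR : IsReverseMVM P ξ) (n : ℕ) : ∀ (k d : ℕ), d + k = n → ∀ (H : Ω → ℝ),
    BddMeas (tailField ξ n) H → ∀ (f : Fin k → S → ℝ), (∀ a, Good (f a)) →
    (n.descFactorial k : ℝ) * ∫ ω, H ω * ∏ a : Fin k, f a (ξ (d + a) ω) ∂P =
      ∫ ω, H ω * ∑ g : Fin k ↪ Fin n, ∏ a, f a (ξ (g a) ω) ∂P := by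
  intro k
  induction k with
  | zero => intro d hd H hH f hf; simp
  | succ k ih =>
    intro d hd H hH f hf
    have hle := tailField_le ξ hξ n
    have hT : tailField ξ n ≤ tailField ξ (d + 1) := tailField_anti ξ (by omega)
    set F : Fin k → S → ℝ := fun a => f a.succ with hF
    have hFg : ∀ a, Good (F a) := fun a => hf _
    have hUg : ∀ a b, Good (Function.update F a (F a * f 0) b) := by
      intro a b
      by_cases h : b = a
      · subst h; simpa using (hFg b).mul (hf 0)
      · simpa [Function.update_of_ne h] using hFg b
    have hU : ∀ (a : Fin k) (x : Fin k → S),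
        ∏ b, Function.update F a (F a * f 0) b (x b) = (∏ b, F b (x b)) * f 0 (x a) := by
      intro a x
      have e : ∀ b, Function.update F a (F a * f 0) b (x b) =
          F b (x b) * (if b = a then f 0 (x a) else 1) := by
        intro b
        by_cases h : b = a
        · subst h; simp
        · simp [h]
      simp_rw [e, Finset.prod_mul_distrib]
      simp
    set p : Ω → ℝ := fun ω => ∑ j ∈ Finset.range n, f 0 (ξ j ω) with hp
    have hpB : BddMeas (tailField ξ n) p := (hf 0).bddMeas_sum ξ le_rfl
    have hprod : BddMeas (tailField ξ (d + 1)) (fun ω => ∏ a : Fin k, F a (ξ (d + 1 + a) ω)) :=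
      BddMeas.prod fun a => (hFg a).bddMeas (measurable_tail_coord ξ (by omega))
    have hG := (hH.mono hT).mul hprod
    have h1 := one_step P ξ hξ hR d _ hG (f 0) (hf 0)
    have ihA := ih (d + 1) (by omega) _ (hH.mul hpB) F hFg
    have ihB := fun a => ih (d + 1) (by omega) _ hH _ (hUg a)
    have hle1 := tailField_le ξ hξ (d + 1)
    have h2 : ∫ ω, (H ω * ∏ a : Fin k, F a (ξ (d + 1 + a) ω)) *
          ∑ j ∈ Finset.range (d + 1), f 0 (ξ j ω) ∂P =
        ∫ ω, (H ω * p ω) * ∏ a : Fin k, F a (ξ (d + 1 + a) ω) ∂P -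
        ∑ a, ∫ ω, H ω * ∏ b : Fin k, Function.update F a (F a * f 0) b (ξ (d + 1 + b) ω) ∂P := by
      rw [← integral_finsetSum, ← integral_sub]
      · refine integral_congr_ae (ae_of_all _ fun ω => ?_)
        have : p ω = ∑ j ∈ Finset.range (d + 1), f 0 (ξ j ω) +
            ∑ a : Fin k, f 0 (ξ (d + 1 + a) ω) := by
          rw [hp]
          simp only
          rw [show n = d + 1 + k by omega, Finset.sum_range_add,
            Fin.sum_univ_eq_sum_range (fun i => f 0 (ξ (d + 1 + i) ω))]
        simp only [hU _ (fun b : Fin k => ξ (d + 1 + b) ω)]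
        rw [this, ← Finset.mul_sum, ← Finset.mul_sum]
        ring
      · exact (((hH.mul hpB).mono hle).mul (hprod.mono hle1)).integrable
      · refine (BddMeas.sum _ fun a _ => ?_).integrable
        exact (hH.mono hle).mul (BddMeas.prod fun b => (hUg a b).bddMeas (hξ _))
      · intro a _
        exact ((hH.mono hle).mul (BddMeas.prod fun b => (hUg a b).bddMeas (hξ _))).integrable
    have h3 : ∫ ω, H ω * ∑ g : Fin (k + 1) ↪ Fin n, ∏ a, f a (ξ (g a) ω) ∂P =
        ∫ ω, (H ω * p ω) * ∑ g : Fin k ↪ Fin n, ∏ a, F a (ξ (g a) ω) ∂P -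
        ∑ a, ∫ ω, H ω * ∑ g : Fin k ↪ Fin n,
          ∏ b, Function.update F a (F a * f 0) b (ξ (g b) ω) ∂P := by
      rw [← integral_finsetSum, ← integral_sub]
      · refine integral_congr_ae (ae_of_all _ fun ω => ?_)
        simp only [fun (a : Fin k) (g : Fin k ↪ Fin n) => hU a (fun b : Fin k => ξ (g b) ω)]
        simp_rw [Fin.prod_univ_succ]
        rw [emb_sum (fun j => f 0 (ξ j ω)) (fun a j => F a (ξ j ω))]
        have : p ω = ∑ j : Fin n, f 0 (ξ j ω) := by
          rw [hp, Fin.sum_univ_eq_sum_range (fun i => f 0 (ξ i ω))]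
        rw [this, ← Finset.mul_sum, Finset.sum_comm, mul_assoc, ← mul_sub]
        congr 1
        rw [Finset.mul_sum, ← Finset.sum_sub_distrib]
        simp_rw [← Finset.mul_sum]
        refine Finset.sum_congr rfl fun g _ => ?_
        ring
      · refine (((hH.mul hpB).mono hle).mul (BddMeas.sum _ fun g _ => ?_)).integrable
        exact BddMeas.prod fun b => (hFg b).bddMeas (hξ _)
      · refine (BddMeas.sum _ fun a _ => ?_).integrable
        refine (hH.mono hle).mul (BddMeas.sum _ fun g _ => ?_)
        exact BddMeas.prod fun b => (hUg a b).bddMeas (hξ _)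
      · intro a _
        refine ((hH.mono hle).mul (BddMeas.sum _ fun g _ => ?_)).integrable
        exact BddMeas.prod fun b => (hUg a b).bddMeas (hξ _)
    rw [h3, ← ihA]
    simp_rw [← ihB]
    rw [← Finset.mul_sum, ← mul_sub, ← h2, ← h1, Nat.descFactorial_succ,
      show n - k = d + 1 by omega]
    have h4 : ∫ ω, H ω * ∏ a : Fin (k + 1), f a (ξ (d + a) ω) ∂P =
        ∫ ω, (H ω * ∏ a : Fin k, F a (ξ (d + 1 + a) ω)) * f 0 (ξ d ω) ∂P := by
      refine integral_congr_ae (ae_of_all _ fun ω => ?_)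
      simp only [Fin.prod_univ_succ, hF, Fin.val_zero, add_zero, Fin.val_succ]
      have e : ∏ a : Fin k, f a.succ (ξ (d + (a + 1)) ω) =
          ∏ a : Fin k, f a.succ (ξ (d + 1 + a) ω) :=
        Finset.prod_congr rfl fun a _ => by rw [add_right_comm, add_assoc]
      rw [e]
      ring
    rw [h4]
    push_cast
    ring

lemma perm_expect {Ω S : Type*} [MeasurableSpace Ω] [MeasurableSpace S]
    (P : Measure Ω) [IsProbabilityMeasure P] (ξ : ℕ → Ω → S) (hξ : ∀ i, Measurable (ξ i))
    (hR : IsReverseMVM P ξ) (n : ℕ) (f : Fin n → S → ℝ) (hf : ∀ a, Good (f a))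
    (σ : Equiv.Perm (Fin n)) :
    ∫ ω, ∏ a, f a (ξ (σ a) ω) ∂P = ∫ ω, ∏ a : Fin n, f a (ξ a ω) ∂P := by
  have h1 := key_id P ξ hξ hR n n 0 (by simp) (fun _ => 1) BddMeas.one f hf
  have h2 := key_id P ξ hξ hR n n 0 (by simp) (fun _ => 1) BddMeas.one
    (fun a => f (σ.symm a)) (fun a => hf _)
  simp only [one_mul, zero_add] at h1 h2
  have h3 : ∀ ω, ∑ g : Fin n ↪ Fin n, ∏ a, f (σ.symm a) (ξ (g a) ω) =
      ∑ g : Fin n ↪ Fin n, ∏ a, f a (ξ (g a) ω) := by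
    intro ω
    rw [← (Equiv.embeddingCongr σ (Equiv.refl (Fin n))).sum_comp]
    refine Finset.sum_congr rfl fun g _ => ?_
    rw [← Equiv.prod_comp σ]
    simp
  have h4 : ∀ ω, ∏ a : Fin n, f (σ.symm a) (ξ a ω) = ∏ a, f a (ξ (σ a) ω) := by
    intro ω
    rw [← Equiv.prod_comp σ]
    simp
  simp_rw [h3, h4, ← h1] at h2
  refine mul_left_cancel₀ ?_ h2
  rw [Nat.descFactorial_self]
  exact_mod_cast n.factorial_ne_zero

lemma perm_law {Ω S : Type*} [MeasurableSpace Ω] [MeasurableSpace S]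
    (P : Measure Ω) [IsProbabilityMeasure P] (ξ : ℕ → Ω → S) (hξ : ∀ i, Measurable (ξ i))
    (hR : IsReverseMVM P ξ) (n : ℕ) (σ : Equiv.Perm (Fin n)) :
    Measure.map (fun ω (a : Fin n) => ξ (σ a) ω) P = Measure.map (fun ω (a : Fin n) => ξ a ω) P := by
  have m1 : Measurable (fun ω (a : Fin n) => ξ (σ a) ω) := measurable_pi_lambda _ fun a => hξ _
  have m2 : Measurable (fun ω (a : Fin n) => ξ a ω) := measurable_pi_lambda _ fun a => hξ _
  have := Measure.isProbabilityMeasure_map (μ := P) m1.aemeasurable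
  refine ext_of_generate_finite _ generateFrom_pi.symm isPiSystem_pi ?_ ?_
  · rintro _ ⟨A, hA, rfl⟩
    have hA' : ∀ a, MeasurableSet (A a) := fun a => hA a (Set.mem_univ a)
    have hm : MeasurableSet (Set.univ.pi A) := MeasurableSet.univ_pi hA'
    have h := perm_expect P ξ hξ hR n (fun a => (A a).indicator (fun _ => 1)) (fun a =>
      ⟨measurable_const.indicator (hA' a), fun x => ⟨Set.indicator_nonneg (fun _ _ => zero_le_one) x,
        Set.indicator_le_self' (f := fun _ => (1 : ℝ)) (fun _ _ => zero_le_one) x⟩⟩) σ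
    have key : ∀ (Y : Ω → Fin n → S), Measurable Y →
        ∫ ω, ∏ a, (A a).indicator (fun _ => (1 : ℝ)) (Y ω a) ∂P =
          (Measure.map Y P).real (Set.univ.pi A) := by
      intro Y hY
      rw [map_measureReal_apply hY hm, ← integral_indicator_one (hY hm)]
      refine integral_congr_ae (ae_of_all _ fun ω => ?_)
      by_cases hω : ∀ a, Y ω a ∈ A a
      · simp [Set.indicator, hω]
      · simp only [Set.indicator, Set.mem_preimage, Set.mem_univ_pi, hω, if_false]
        push Not at hω
        obtain ⟨a, ha⟩ := hω
        exact Finset.prod_eq_zero (Finset.mem_univ a) (by simp [ha])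
    rw [key _ m1, key _ m2] at h
    have := Measure.isProbabilityMeasure_map (μ := P) m2.aemeasurable
    rwa [measureReal_def, measureReal_def, ENNReal.toReal_eq_toReal_iff'
      (measure_ne_top _ _) (measure_ne_top _ _)] at h
  · rw [Measure.map_apply m1 .univ, Measure.map_apply m2 .univ]; simp

/-- equality of laws from equality of finite dimensional laws -/
lemma law_ext {Ω S ι : Type*} [MeasurableSpace Ω] [MeasurableSpace S]
    (P : Measure Ω) [IsProbabilityMeasure P] (X Y : ι → Ω → S) (hX : ∀ i, Measurable (X i))
    (hY : ∀ i, Measurable (Y i))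
    (h : ∀ I : Finset ι, Measure.map (fun ω (i : I) => X i ω) P =
      Measure.map (fun ω (i : I) => Y i ω) P) :
    Measure.map (fun ω i => X i ω) P = Measure.map (fun ω i => Y i ω) P := by
  have m1 : Measurable (fun ω i => X i ω) := measurable_pi_lambda _ hX
  have m2 : Measurable (fun ω i => Y i ω) := measurable_pi_lambda _ hY
  have m3 : ∀ I : Finset ι, Measurable (fun ω (i : I) => Y i ω) :=
    fun I => measurable_pi_lambda _ fun i => hY i
  have : ∀ I : Finset ι, IsFiniteMeasure (Measure.map (fun ω (i : I) => Y i ω) P) := fun I => by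
    infer_instance
  refine IsProjectiveLimit.unique (P := fun I : Finset ι => Measure.map (fun ω (i : I) => Y i ω) P)
    (fun I => ?_) (fun I => ?_)
  · rw [Measure.map_map (Finset.measurable_restrict I) m1]; exact h I
  · rw [Measure.map_map (Finset.measurable_restrict I) m2]; rfl

lemma map_of_map {Ω A B : Type*} [MeasurableSpace Ω] [MeasurableSpace A] [MeasurableSpace B]
    {P : Measure Ω} {X Y : Ω → A} (hX : Measurable X) (hY : Measurable Y)
    (h : Measure.map X P = Measure.map Y P) {φ : A → B} (hφ : Measurable φ) :
    Measure.map (fun ω => φ (X ω)) P = Measure.map (fun ω => φ (Y ω)) P := by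
  have := congrArg (Measure.map φ) h
  rwa [Measure.map_map hφ hX, Measure.map_map hφ hY] at this

lemma exists_perm (q : Equiv.Perm ℕ) (I : Finset ℕ) :
    ∃ n, ∃ σ : Equiv.Perm (Fin n), (∀ i ∈ I, i < n) ∧
      ∀ (i : ℕ) (_ : i ∈ I) (h : i < n), ((σ ⟨i, h⟩ : Fin n) : ℕ) = q i := by
  set n := (I ∪ I.image q).sup id + 1 with hn
  have h1 : ∀ i ∈ I, i < n := fun i hi =>
    Nat.lt_succ_of_le (Finset.le_sup (f := id) (Finset.mem_union_left _ hi))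
  have h2 : ∀ i ∈ I, q i < n := fun i hi =>
    Nat.lt_succ_of_le (Finset.le_sup (f := id)
      (Finset.mem_union_right _ (Finset.mem_image_of_mem _ hi)))
  let e : {x : Fin n // (x : ℕ) ∈ I} ≃ {x : Fin n // q.symm (x : ℕ) ∈ I} :=
    { toFun := fun x => ⟨⟨q x.1, h2 _ x.2⟩, by simpa using x.2⟩
      invFun := fun x => ⟨⟨q.symm x.1, h1 _ x.2⟩, x.2⟩
      left_inv := fun x => by ext; simp
      right_inv := fun x => by ext; simp }
  refine ⟨n, e.extendSubtype, h1, fun i hi h => ?_⟩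
  rw [Equiv.extendSubtype_apply_of_mem e ⟨i, h⟩ hi]
  rfl

lemma exch_of_reverse {Ω S : Type*} [MeasurableSpace Ω] [MeasurableSpace S]
    (P : Measure Ω) [IsProbabilityMeasure P] (ξ : ℕ → Ω → S) (hξ : ∀ i, Measurable (ξ i))
    (hR : IsReverseMVM P ξ) (q : Equiv.Perm ℕ) :
    Measure.map (fun ω i => ξ (q i) ω) P = Measure.map (fun ω i => ξ i ω) P := by
  refine law_ext P _ _ (fun i => hξ _) hξ fun I => ?_
  obtain ⟨n, σ, h1, h2⟩ := exists_perm q I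
  have h := map_of_map (measurable_pi_lambda _ fun a => hξ _) (measurable_pi_lambda _ fun a => hξ _)
    (perm_law P ξ hξ hR n σ) (φ := fun (x : Fin n → S) (i : I) => x ⟨i, h1 i i.2⟩)
    (measurable_pi_lambda _ fun i => measurable_pi_apply _)
  simp only [fun i : I => h2 i i.2 (h1 i i.2)] at h
  exact h

lemma sep_of_exch {Ω S : Type*} [MeasurableSpace Ω] [MeasurableSpace S]
    (P : Measure Ω) [IsProbabilityMeasure P] (X : ℕ → ℕ → Ω → S)
    (hX : ∀ i j, Measurable (X i j))
    (hc : ∀ n : ℕ, 1 ≤ n → ∀ q : Equiv.Perm ℕ,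
      Measure.map (fun ω j (i : Fin n) => X i (q j) ω) P =
      Measure.map (fun ω j (i : Fin n) => X i j ω) P)
    (hr : ∀ m : ℕ, 1 ≤ m → ∀ p : Equiv.Perm ℕ,
      Measure.map (fun ω i (j : Fin m) => X (p i) j ω) P =
      Measure.map (fun ω i (j : Fin m) => X i j ω) P) : SepExchangeable P X := by
  intro p q
  have hq : Measure.map (fun ω (ij : ℕ × ℕ) => X ij.1 (q ij.2) ω) P =
      Measure.map (fun ω (ij : ℕ × ℕ) => X ij.1 ij.2 ω) P := by
    refine law_ext P (fun ij : ℕ × ℕ => X ij.1 (q ij.2)) (fun ij : ℕ × ℕ => X ij.1 ij.2)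
      (fun _ => hX _ _) (fun _ => hX _ _) fun I => ?_
    set n := I.sup Prod.fst + 1 with hn
    have h1 : ∀ i ∈ I, i.1 < n := fun i hi => Nat.lt_succ_of_le (Finset.le_sup (f := Prod.fst) hi)
    exact map_of_map (measurable_pi_lambda _ fun a => measurable_pi_lambda _ fun b => hX _ _)
      (measurable_pi_lambda _ fun a => measurable_pi_lambda _ fun b => hX _ _)
      (hc n (by omega) q) (φ := fun (x : ℕ → Fin n → S) (i : I) => x i.1.2 ⟨i.1.1, h1 i i.2⟩)
      (measurable_pi_lambda _ fun i => (measurable_pi_apply _).comp (measurable_pi_apply _))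
  have hp : Measure.map (fun ω (ij : ℕ × ℕ) => X (p ij.1) ij.2 ω) P =
      Measure.map (fun ω (ij : ℕ × ℕ) => X ij.1 ij.2 ω) P := by
    refine law_ext P (fun ij : ℕ × ℕ => X (p ij.1) ij.2) (fun ij : ℕ × ℕ => X ij.1 ij.2)
      (fun _ => hX _ _) (fun _ => hX _ _) fun I => ?_
    set n := I.sup Prod.snd + 1 with hn
    have h1 : ∀ i ∈ I, i.2 < n := fun i hi => Nat.lt_succ_of_le (Finset.le_sup (f := Prod.snd) hi)
    exact map_of_map (measurable_pi_lambda _ fun a => measurable_pi_lambda _ fun b => hX _ _)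
      (measurable_pi_lambda _ fun a => measurable_pi_lambda _ fun b => hX _ _)
      (hr n (by omega) p) (φ := fun (x : ℕ → Fin n → S) (i : I) => x i.1.1 ⟨i.1.2, h1 i i.2⟩)
      (measurable_pi_lambda _ fun i => (measurable_pi_apply _).comp (measurable_pi_apply _))
  rw [← hp]
  exact map_of_map (measurable_pi_lambda _ fun _ => hX _ _) (measurable_pi_lambda _ fun _ => hX _ _)
    hq (φ := fun (x : ℕ × ℕ → S) (ij : ℕ × ℕ) => x (p ij.1, ij.2))
    (measurable_pi_lambda _ fun i => measurable_pi_apply _)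

/-- the cyclic permutation of `0, …, n` -/
def cyc (n : ℕ) : Equiv.Perm ℕ where
  toFun i := if i < n then i + 1 else if i = n then 0 else i
  invFun i := if i = 0 then n else if i ≤ n then i - 1 else i
  left_inv i := by simp only; grind
  right_inv i := by simp only; grind

lemma stationary_of_exch {Ω S : Type*} [MeasurableSpace Ω] [MeasurableSpace S]
    (P : Measure Ω) [IsProbabilityMeasure P] (ξ : ℕ → Ω → S) (hξ : ∀ i, Measurable (ξ i))
    (h : ∀ q : Equiv.Perm ℕ, Measure.map (fun ω i => ξ (q i) ω) P =
      Measure.map (fun ω i => ξ i ω) P) : Stationary P ξ := by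
  refine law_ext P (fun i => ξ (i + 1)) ξ (fun i => hξ _) hξ fun I => ?_
  have h1 : ∀ i ∈ I, i < I.sup id + 1 :=
    fun i hi => Nat.lt_succ_of_le (Finset.le_sup (f := id) hi)
  have h2 := map_of_map (measurable_pi_lambda _ fun a => hξ _) (measurable_pi_lambda _ fun a => hξ _)
    (h (cyc (I.sup id + 1))) (φ := fun (x : ℕ → S) (i : I) => x i)
    (measurable_pi_lambda _ fun i => measurable_pi_apply _)
  have h3 : ∀ i : I, cyc (I.sup id + 1) i = i + 1 := fun i => by
    show (if _ then _ else _) = _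
    rw [if_pos (h1 i i.2)]
  simp only [h3] at h2
  exact h2

lemma emp_swap {S : Type*} [MeasurableSpace S] {j n k : ℕ} (hj : j < n) (hk : n ≤ k)
    (x : ℕ → S) :
    empDist (fun i (y : ℕ → S) => y i) k (fun i => x (Equiv.swap 0 j i)) =
      empDist (fun i (y : ℕ → S) => y i) k x := by
  simp only [empDist]
  congr 1
  refine Finset.sum_equiv (Equiv.swap 0 j) (fun i => ?_) (fun i _ => rfl)
  simp only [Finset.mem_range, Equiv.swap_apply_def]
  split_ifs <;> omega

lemma reverse_of_exch {Ω S : Type*} [MeasurableSpace Ω] [MeasurableSpace S]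
    (P : Measure Ω) [IsProbabilityMeasure P] (ξ : ℕ → Ω → S) (hξ : ∀ i, Measurable (ξ i))
    (h : ∀ q : Equiv.Perm ℕ, Measure.map (fun ω i => ξ (q i) ω) P =
      Measure.map (fun ω i => ξ i ω) P) : IsReverseMVM P ξ := by
  intro f hf hb k n hk hkn
  have hle := tailField_le ξ hξ n
  obtain ⟨C, hC⟩ := hb
  have hfi : ∀ i, Integrable (fun ω => f (ξ i ω)) P := fun i =>
    Integrable.of_bound (hf.comp (hξ i)).aestronglyMeasurable C (ae_of_all _ fun ω => hC _)
  have mξ : Measurable (fun ω i => ξ i ω) := measurable_pi_lambda _ hξ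
  have hswap : ∀ A, MeasurableSet[tailField ξ n] A → ∀ j < n,
      ∫ ω in A, f (ξ j ω) ∂P = ∫ ω in A, f (ξ 0 ω) ∂P := by
    intro A hA j hj
    have e1 : tailField ξ n ≤ MeasurableSpace.comap (fun ω i => ξ i ω)
        (MeasurableSpace.invariants (fun (x : ℕ → S) i => x (Equiv.swap 0 j i))) := by
      refine iSup_le fun l => iSup_le fun hl => ?_
      rintro _ ⟨B, hB, rfl⟩
      refine ⟨empDist (fun i (y : ℕ → S) => y i) l ⁻¹' B, ?_, rfl⟩
      refine ⟨measurable_empDist _ (fun i => measurable_pi_apply i) l hB, ?_⟩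
      ext x
      simp only [Set.mem_preimage]
      rw [emp_swap hj hl x]
    obtain ⟨B, ⟨hBm, hBi⟩, rfl⟩ := e1 A hA
    have e2 : ∀ i, Measurable (fun x : ℕ → S => B.indicator (fun x => f (x i)) x) := fun i =>
      (hf.comp (measurable_pi_apply i)).indicator hBm
    have e3 : ∀ i, ∫ ω in (fun ω i => ξ i ω) ⁻¹' B, f (ξ i ω) ∂P =
        ∫ x, B.indicator (fun x => f (x i)) x ∂(Measure.map (fun ω i => ξ i ω) P) := by
      intro i
      rw [integral_map mξ.aemeasurable (e2 i).aestronglyMeasurable, ← integral_indicator (mξ hBm)]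
      rfl
    rw [e3, e3, ← h (Equiv.swap 0 j), integral_map
      (measurable_pi_lambda _ fun i => hξ _).aemeasurable (e2 j).aestronglyMeasurable,
      h (Equiv.swap 0 j), integral_map mξ.aemeasurable (e2 0).aestronglyMeasurable]
    refine integral_congr_ae (ae_of_all _ fun ω => ?_)
    have e4 : (fun i => ξ (Equiv.swap 0 j i) ω) ∈ B ↔ (fun i => ξ i ω) ∈ B :=
      Set.ext_iff.1 hBi (fun i => ξ i ω)
    by_cases hω : (fun i => ξ i ω) ∈ B
    · have hω' := e4.2 hω
      simp [Set.indicator, hω, hω']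
    · have hω' : (fun i => ξ (Equiv.swap 0 j i) ω) ∉ B := fun h => hω (e4.1 h)
      simp [Set.indicator, hω, hω']
  have hset : ∀ A, MeasurableSet[tailField ξ n] A → ∀ l, 1 ≤ l → l ≤ n →
      ∫ ω in A, ∫ x, f x ∂(empDist ξ l ω) ∂P = ∫ ω in A, f (ξ 0 ω) ∂P := by
    intro A hA l hl hln
    simp_rw [integral_empDist ξ f hf]
    rw [integral_const_mul, integral_finsetSum _ fun i _ => (hfi i).integrableOn,
      Finset.sum_congr rfl fun i hi => hswap A hA i ((Finset.mem_range.1 hi).trans_le hln)]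
    have : (l : ℝ) ≠ 0 := by positivity
    simp [this]
  have hint : ∀ l, Integrable (fun ω => ∫ x, f x ∂(empDist ξ l ω)) P := fun l => by
    simp_rw [integral_empDist ξ f hf]
    exact (integrable_finsetSum _ fun i _ => hfi i).const_mul _
  symm
  refine ae_eq_condExp_of_forall_setIntegral_eq hle (hint k)
    (fun s _ _ => (hint n).integrableOn)
    (fun s hs _ => by rw [hset s hs n (hk.trans hkn) le_rfl, hset s hs k hk hkn]) ?_
  refine StronglyMeasurable.aestronglyMeasurable (Measurable.stronglyMeasurable ?_)
  have e5 : (fun ω => ∫ x, f x ∂(empDist ξ n ω)) =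
      fun ω => (n : ℝ)⁻¹ * (∑ i ∈ Finset.range n, (f (ξ i ω) + C) - n * C) := by
    funext ω
    rw [integral_empDist ξ f hf, Finset.sum_add_distrib]
    simp
  rw [e5]
  have := measurable_sum_nonneg ξ (fun x => f x + C) (hf.add_const C)
    (fun x => by have := abs_le.1 (hC x); linarith) (le_refl n)
  exact (this.sub_const _).const_mul _

end SepExchAux

/-- **marginal characterisation.** An infinite random matrix `X` with values
in a standard Borel space is separately exchangeable if and only if, for every `n, m ≥ 1`,
the empirical distributions of the sequence of column vectors `Y^n_j = (X_{1,j}, …, X_{n,j})`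
and of the sequence of row vectors `Z^m_i = (X_{i,1}, …, X_{i,m})` are reverse measure-valued
martingales, and these sequences are stationary. -/
theorem sepExchangeable_iff_marginal_reverseMVM_stationary
    {Ω S : Type*} [MeasurableSpace Ω] [MeasurableSpace S] [StandardBorelSpace S]
    (P : Measure Ω) [IsProbabilityMeasure P] (X : ℕ → ℕ → Ω → S)
    (hmeas : ∀ i j, Measurable (X i j)) :
    SepExchangeable P X ↔
      ((∀ n : ℕ, 1 ≤ n →
          IsReverseMVM P (fun j ω (i : Fin n) => X (i : ℕ) j ω) ∧
          Stationary P (fun j ω (i : Fin n) => X (i : ℕ) j ω)) ∧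
        (∀ m : ℕ, 1 ≤ m →
          IsReverseMVM P (fun i ω (j : Fin m) => X i (j : ℕ) ω) ∧
          Stationary P (fun i ω (j : Fin m) => X i (j : ℕ) ω))) := by
  constructor
  · intro h
    have hmc : ∀ n j, Measurable (fun ω (i : Fin n) => X (i : ℕ) j ω) :=
      fun n j => measurable_pi_lambda _ fun i => hmeas _ _
    have hmr : ∀ n i, Measurable (fun ω (j : Fin n) => X i (j : ℕ) ω) :=
      fun n j => measurable_pi_lambda _ fun i => hmeas _ _
    have hc : ∀ n : ℕ, ∀ q : Equiv.Perm ℕ,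
        Measure.map (fun ω j (i : Fin n) => X i (q j) ω) P =
        Measure.map (fun ω j (i : Fin n) => X i j ω) P := fun n q =>
      SepExchAux.map_of_map (measurable_pi_lambda _ fun _ => hmeas _ _)
        (measurable_pi_lambda _ fun _ => hmeas _ _) (h 1 q)
        (φ := fun (x : ℕ × ℕ → S) j (i : Fin n) => x (i, j))
        (measurable_pi_lambda _ fun i => measurable_pi_lambda _ fun j => measurable_pi_apply _)
    have hr : ∀ m : ℕ, ∀ p : Equiv.Perm ℕ,
        Measure.map (fun ω i (j : Fin m) => X (p i) j ω) P =
        Measure.map (fun ω i (j : Fin m) => X i j ω) P := fun m p =>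
      SepExchAux.map_of_map (measurable_pi_lambda _ fun _ => hmeas _ _)
        (measurable_pi_lambda _ fun _ => hmeas _ _) (h p 1)
        (φ := fun (x : ℕ × ℕ → S) i (j : Fin m) => x (i, j))
        (measurable_pi_lambda _ fun i => measurable_pi_lambda _ fun j => measurable_pi_apply _)
    exact ⟨fun n _ => ⟨SepExchAux.reverse_of_exch P _ (hmc n) (hc n),
        SepExchAux.stationary_of_exch P _ (hmc n) (hc n)⟩,
      fun m _ => ⟨SepExchAux.reverse_of_exch P _ (hmr m) (hr m),
        SepExchAux.stationary_of_exch P _ (hmr m) (hr m)⟩⟩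
  · rintro ⟨hc, hr⟩
    exact SepExchAux.sep_of_exch P X hmeas
      (fun n hn q => SepExchAux.exch_of_reverse P (fun j ω (i : Fin n) => X (i : ℕ) j ω)
        (fun j => measurable_pi_lambda _ fun i => hmeas _ _) (hc n hn).1 q)
      (fun m hm p => SepExchAux.exch_of_reverse P (fun i ω (j : Fin m) => X i (j : ℕ) ω)
        (fun j => measurable_pi_lambda _ fun i => hmeas _ _) (hr m hm).1 p)
end
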